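/- arXiv:2206.09838 — 2 statements merged into one kernel-verified Lean document; each statement's English description precedes it below -/
import Mathlib

section
/- Let X be a Banach lattice with a directed bounded generating system Π such that σ(X) ∈ 𝔉_X^{⋆,μ} for every σ ∈ Π, for some μ ≥ 1; for each σ ∈ Π let (x_i^{(σ)}) be a shrinking basis for σ(X) satisfying (⋆) with constant μ in each summand and let (e_n^{(σ)}) be the corresponding partial-sum projections, regarded as elements ι_σ e_n^{(σ)} p_σ of ℒʳ(X). Suppose in addition that lim_σ ‖λ − λ∘σ‖ = 0 for every λ ∈ X′. Let e := id_X and let 𝔛 be a Banach lattice ℒʳ(X)-module such that weak*-lim_σ σ·x′ = e·x′ and weak*-lim_σ x′·σ = x′·e for every x′ ∈ 𝔛′, and weak*-lim_n e_n^{(σ)}·x′ = σ·x′ and weak*-lim_n x′·e_n^{(σ)} = x′·σ for every x′ ∈ 𝔛′ and σ ∈ Π. If in addition one of the following holds, then every bounded derivation D : ℒʳ(X) → 𝔛′ is regular: (i) X contains no subspace isomorphic to ℓ₁ and 𝔛 contains no complemented subspace isomorphic to ℓ₁; (ii) X is reflexive and dim(e_n^{(σ)}·𝔛′·e_n^{(σ)})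 < ∞ for all n ∈ ℕ and σ ∈ Π; (iii) X contains no subspace isomorphic to ℓ₁ and every bounded derivation from 𝒜ʳ(X) to 𝔛′ is inner. -/
/- STATEMENT 9 (Corollary C1, non-atomic case): regularity of every bounded derivation
   from ℒʳ(X) into the dual of a Banach lattice ℒʳ(X)-module, for X with a directed
   bounded generating system whose ranges lie in F_X^{star,mu}, under conditions
   (i), (ii) or (iii). -/

open Filter Topology

section Prelude

variable {X 𝔛 : Type*} [NormedAddCommGroup X] [Lattice X] [HasSolidNorm X] [IsOrderedAddMonoid X] [NormedSpace ℝ X]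
variable [NormedAddCommGroup 𝔛] [Lattice 𝔛] [HasSolidNorm 𝔛] [IsOrderedAddMonoid 𝔛] [NormedSpace ℝ 𝔛]

/-- A bounded operator is positive if it maps the positive cone into itself. -/
def IsPosOp (T : X →L[ℝ] X) : Prop := ∀ x : X, 0 ≤ x → 0 ≤ T x

/-- The operator order on regular operators. -/
def opLe (S T : X →L[ℝ] X) : Prop := IsPosOp (T - S)

/-- ℒʳ(X): the regular operators, i.e. linear combinations of positive operators. -/
def LrSet (X : Type*) [NormedAddCommGroup X] [Lattice X] [HasSolidNorm X] [IsOrderedAddMonoid X] [NormedSpace ℝ X] :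
    Set (X →L[ℝ] X) :=
  {T | ∃ (n : ℕ) (c : Fin n → ℝ) (S : Fin n → X →L[ℝ] X),
    (∀ i, IsPosOp (S i)) ∧ T = ∑ i, c i • S i}

/-- The regular norm ‖T‖ᵣ = inf{‖S‖ : |Tx| ≤ S|x| for all x}. -/
noncomputable def rnorm (T : X →L[ℝ] X) : ℝ :=
  sInf {c : ℝ | ∃ S : X →L[ℝ] X, ‖S‖ = c ∧ ∀ x : X, |T x| ≤ S |x|}

/-- ℱ(X): continuous finite-rank operators. -/
def FinRankOp (T : X →L[ℝ] X) : Prop :=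
  ∃ (n : ℕ) (f : Fin n → X →L[ℝ] ℝ) (v : Fin n → X), T = ∑ i, (f i).smulRight (v i)

/-- 𝒜ʳ(X): the ‖·‖ᵣ-closure of ℱ(X) in ℒʳ(X). -/
def ArSet (X : Type*) [NormedAddCommGroup X] [Lattice X] [HasSolidNorm X] [IsOrderedAddMonoid X] [NormedSpace ℝ X] :
    Set (X →L[ℝ] X) :=
  {T | T ∈ LrSet X ∧ ∀ ε : ℝ, 0 < ε → ∃ F : X →L[ℝ] X, FinRankOp F ∧ rnorm (T - F) < ε}

/-- x is a normalized atom of the Banach lattice X. -/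
def IsNormAtom (a : X) : Prop :=
  0 < a ∧ ‖a‖ = 1 ∧ ∀ y : X, 0 ≤ y → y ≤ a → ∃ c : ℝ, y = c • a

/-- The dual (pointwise-on-the-cone) order on 𝔛′ = 𝔛 →L[ℝ] ℝ. -/
def dualLe (f g : 𝔛 →L[ℝ] ℝ) : Prop := ∀ y : 𝔛, 0 ≤ y → f y ≤ g y

/-- Least upper bound with respect to the dual order. -/
def dualIsLUB (S : Set (𝔛 →L[ℝ] ℝ)) (f : 𝔛 →L[ℝ] ℝ) : Prop :=
  (∀ g ∈ S, dualLe g f) ∧ ∀ h : 𝔛 →L[ℝ] ℝ, (∀ g ∈ S, dualLe g h) → dualLe f h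

/-- A subset of the dual is weak*-closed. -/
def wstarClosed (S : Set (𝔛 →L[ℝ] ℝ)) : Prop :=
  IsClosed (StrongDual.toWeakDual '' S)

/-- (y i)_{i<n} and (z i)_{i<n} are L-equivalent. -/
def seqEquivUpTo (L : ℝ) (n : ℕ) (y z : ℕ → X) : Prop :=
  ∀ α : ℕ → ℝ,
    ‖∑ i ∈ Finset.range n, α i • y i‖ ≤ L * ‖∑ i ∈ Finset.range n, α i • z i‖ ∧
    ‖∑ i ∈ Finset.range n, α i • z i‖ ≤ L * ‖∑ i ∈ Finset.range n, α i • y i‖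

/-- The sequence (x i) satisfies the selection property (⋆) with constant μ. -/
def StarSeq (μ : ℝ) (x : ℕ → X) : Prop :=
  ∃ μs : ℕ → ℝ, (∀ n, 1 ≤ μs n ∧ μs n ≤ μ) ∧
    ∀ (n : ℕ) (l : ℕ → ℕ), 0 < n → (∀ i j, i < j → j < n → l i < l j) →
      seqEquivUpTo (μs n) n x (fun i => x (l i)) →
      ∀ k : ℕ, ∃ m : ℕ, l (n - 1) + k ≤ m ∧
        seqEquivUpTo (μs (n + 1)) (n + 1) x (fun i => x (Function.update l n m i))

/-- (x i) is (an enumeration of the normalized atoms of X forming) a basis for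
X = (⊕_n X_n)_𝐞 satisfying (⋆) with constant μ in each summand: there is a partition
of ℕ into slices (ψ n ·), n ∈ I, order preserving on each slice, such that on each
slice the (⋆)-property holds with constant μ, the slices are pairwise disjoint
sublattices, and the decomposition into slices is 1-unconditional. -/
def StarSummandBasis (μ : ℝ) (x : ℕ → X) : Prop :=
  ∃ (I : Set ℕ) (ψ : ℕ → ℕ → ℕ),
    (∀ n ∈ I, StrictMono (ψ n)) ∧
    (∀ i : ℕ, ∃! p : ℕ × ℕ, p.1 ∈ I ∧ ψ p.1 p.2 = i) ∧
    (∀ n ∈ I, StarSeq μ (fun j => x (ψ n j))) ∧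
    (∀ i, IsNormAtom (x i)) ∧
    (∀ a : X, IsNormAtom a → ∃ i, x i = a) ∧
    (∀ n ∈ I, ∀ m ∈ I, n ≠ m → ∀ j j' : ℕ, x (ψ n j) ⊓ x (ψ m j') = 0) ∧
    (∀ (s : Finset ℕ) (α ε : ℕ → ℝ),
      (∀ n ∈ I, ∀ j j' : ℕ, ε (ψ n j) = ε (ψ n j')) → (∀ i, |ε i| ≤ 1) →
      ‖∑ i ∈ s, (ε i * α i) • x i‖ ≤ ‖∑ i ∈ s, α i • x i‖)

/-- A sequence in the dual is equivalent to the unit vector basis of c₀. -/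
def EquivC0Basis (ξ : ℕ → (𝔛 →L[ℝ] ℝ)) : Prop :=
  ∃ L : ℝ, 0 < L ∧ ∀ (m : ℕ) (α : ℕ → ℝ),
    (∀ j < m, |α j| ≤ L * ‖∑ i ∈ Finset.range m, α i • ξ i‖) ∧
    (∀ B : ℝ, 0 ≤ B → (∀ i < m, |α i| ≤ B) →
      ‖∑ i ∈ Finset.range m, α i • ξ i‖ ≤ L * B)

/-- A map D defined (at least) on A ⊆ ℒʳ(X), with values in 𝔛′, is regular if on A it
is a finite linear combination of positive linear maps. -/
def RegularDerivOn (A : Set (X →L[ℝ] X)) (D : (X →L[ℝ] X) → (𝔛 →L[ℝ] ℝ)) : Prop :=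
  ∃ (n : ℕ) (c : Fin n → ℝ) (P : Fin n → (X →L[ℝ] X) → (𝔛 →L[ℝ] ℝ)),
    (∀ t, (∀ a ∈ A, ∀ b ∈ A, P t (a + b) = P t a + P t b) ∧
          (∀ (r : ℝ), ∀ a ∈ A, P t (r • a) = r • P t a) ∧
          (∀ a ∈ A, IsPosOp a → dualLe 0 (P t a))) ∧
    ∀ a ∈ A, D a = ∑ t, c t • P t a

/-- 𝔛 contains a complemented subspace isomorphic to ℓ₁. -/
def HasComplementedL1 (𝔛 : Type*) [NormedAddCommGroup 𝔛] [Lattice 𝔛] [HasSolidNorm 𝔛] [IsOrderedAddMonoid 𝔛] [NormedSpace ℝ 𝔛] :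
    Prop :=
  ∃ (P : 𝔛 →L[ℝ] 𝔛) (e : ℕ → 𝔛) (L : ℝ), 0 < L ∧ P ∘L P = P ∧
    (∀ y : 𝔛, P y ∈ closure (Submodule.span ℝ (Set.range e) : Set 𝔛)) ∧
    (∀ i, P (e i) = e i) ∧
    (∀ (m : ℕ) (α : ℕ → ℝ),
      L⁻¹ * ∑ i ∈ Finset.range m, |α i| ≤ ‖∑ i ∈ Finset.range m, α i • e i‖ ∧
      ‖∑ i ∈ Finset.range m, α i • e i‖ ≤ L * ∑ i ∈ Finset.range m, |α i|)

end Prelude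

section Prelude2

variable {X 𝔛 : Type*} [NormedAddCommGroup X] [Lattice X] [HasSolidNorm X] [IsOrderedAddMonoid X] [NormedSpace ℝ X]
variable [NormedAddCommGroup 𝔛] [Lattice 𝔛] [HasSolidNorm 𝔛] [IsOrderedAddMonoid 𝔛] [NormedSpace ℝ 𝔛]

/-- a is a normalized atom of the sublattice V of X. -/
def IsNormAtomOn (V : Set X) (a : X) : Prop :=
  a ∈ V ∧ 0 < a ∧ ‖a‖ = 1 ∧ ∀ y ∈ V, 0 ≤ y → y ≤ a → ∃ c : ℝ, y = c • a

/-- (x i) is a basis of the sublattice V of X satisfying (⋆) with constant μ in each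
summand of a 1-unconditional decomposition of V (this encodes V ∈ 𝔉_X^{⋆,μ} together
with the choice of such a basis). -/
def StarSummandBasisOn (V : Set X) (μ : ℝ) (x : ℕ → X) : Prop :=
  ∃ (I : Set ℕ) (ψ : ℕ → ℕ → ℕ),
    (∀ n ∈ I, StrictMono (ψ n)) ∧
    (∀ i : ℕ, ∃! p : ℕ × ℕ, p.1 ∈ I ∧ ψ p.1 p.2 = i) ∧
    (∀ n ∈ I, StarSeq μ (fun j => x (ψ n j))) ∧
    (∀ i, IsNormAtomOn V (x i)) ∧
    (∀ a : X, IsNormAtomOn V a → ∃ i, x i = a) ∧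
    (∀ n ∈ I, ∀ m ∈ I, n ≠ m → ∀ j j' : ℕ, x (ψ n j) ⊓ x (ψ m j') = 0) ∧
    (∀ (s : Finset ℕ) (α ε : ℕ → ℝ),
      (∀ n ∈ I, ∀ j j' : ℕ, ε (ψ n j) = ε (ψ n j')) → (∀ i, |ε i| ≤ 1) →
      ‖∑ i ∈ s, (ε i * α i) • x i‖ ≤ ‖∑ i ∈ s, α i • x i‖)

/-- The partial-sum (natural) projections of a basis, as operators on X. -/
noncomputable def eproj (xb : ℕ → X) (xsb : ℕ → X →L[ℝ] ℝ) (n : ℕ) : X →L[ℝ] X :=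
  ∑ i ∈ Finset.range n, (xsb i).smulRight (xb i)

/-- 𝒜_σ := {a ∈ ℒʳ(σ(X)) : ι_σ a p_σ ∈ 𝒜}, realised inside ℒʳ(X) as the set of
elements b of 𝒜 with σ ∘ b ∘ σ = b. -/
def ASigma (A : Set (X →L[ℝ] X)) (σ : X →L[ℝ] X) : Set (X →L[ℝ] X) :=
  {b | b ∈ A ∧ σ ∘L (b ∘L σ) = b}

/-- The filter of "eventually for all σ large enough" along the directed set Π,
ordered by σ₁ ≼ σ₂ ⟺ σ₁(X) ⊆ σ₂(X). -/
def piFilter (Pi : Set (X →L[ℝ] X)) : Filter {σ : X →L[ℝ] X // σ ∈ Pi} :=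
  ⨅ σ₀ : {σ : X →L[ℝ] X // σ ∈ Pi},
    Filter.principal {σ | Set.range ⇑(σ₀.val) ⊆ Set.range ⇑(σ.val)}

end Prelude2

/-- Y contains a subspace isomorphic to ℓ₁ (witnessed by a sequence equivalent to the
unit vector basis of ℓ₁). -/
def HasL1Copy (Y : Type*) [NormedAddCommGroup Y] [NormedSpace ℝ Y] : Prop :=
  ∃ (e : ℕ → Y) (L : ℝ), 0 < L ∧ ∀ (m : ℕ) (α : ℕ → ℝ),
    L⁻¹ * ∑ i ∈ Finset.range m, |α i| ≤ ‖∑ i ∈ Finset.range m, α i • e i‖ ∧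
    ‖∑ i ∈ Finset.range m, α i • e i‖ ≤ L * ∑ i ∈ Finset.range m, |α i|

set_option linter.unusedSectionVars false

section OrderedSpace

variable {E : Type*} [NormedAddCommGroup E] [Lattice E] [HasSolidNorm E] [IsOrderedAddMonoid E]

theorem nonneg_of_two_pow_nsmul_nonneg (n : ℕ) {x : E} (h : 0 ≤ (2 ^ n) • x) : 0 ≤ x := by
  induction n with
  | zero => simpa using h
  | succ k ih =>
    refine ih (nsmul_two_semiclosed ?_)
    rwa [← mul_nsmul, ← pow_succ]

theorem inf_add_le_of_nonneg {a b c : E} (ha : 0 ≤ a) (hb : 0 ≤ b) (hc : 0 ≤ c) :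
    c ⊓ (a + b) ≤ c ⊓ a + c ⊓ b := by
  rw [← sub_le_iff_le_add, sub_inf]
  refine sup_le (le_inf ?_ ?_) (le_inf ?_ ?_)
  · exact (sub_nonpos.2 inf_le_left).trans hc
  · exact (sub_nonpos.2 inf_le_left).trans ha
  · exact (sub_le_self _ hb).trans inf_le_left
  · exact sub_le_iff_le_add.2 inf_le_right

theorem inf_sum_eq_zero {ι : Type*} (s : Finset ι) {a : E} (ha : 0 ≤ a) (b : ι → E)
    (hb : ∀ i ∈ s, 0 ≤ b i) (h : ∀ i ∈ s, a ⊓ b i = 0) : a ⊓ ∑ i ∈ s, b i = 0 := by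
  classical
  induction s using Finset.induction_on with
  | empty => simpa using ha
  | insert j s hj ih =>
    rw [Finset.sum_insert hj]
    have h0 : 0 ≤ ∑ i ∈ s, b i :=
      Finset.sum_nonneg fun i hi => hb i (Finset.mem_insert_of_mem hi)
    have hbj := hb j (Finset.mem_insert_self j s)
    refine le_antisymm ((inf_add_le_of_nonneg hbj h0 ha).trans ?_) (le_inf ha (add_nonneg hbj h0))
    rw [h j (Finset.mem_insert_self j s), ih (fun i hi => hb i (Finset.mem_insert_of_mem hi))
      fun i hi => h i (Finset.mem_insert_of_mem hi), add_zero]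

variable [NormedSpace ℝ E]

theorem smul_nonneg_of_hasSolidNorm {r : ℝ} (hr : 0 ≤ r) {x : E} (hx : 0 ≤ x) : 0 ≤ r • x := by
  have hlim : Tendsto (fun n : ℕ => ((⌊r * 2 ^ n⌋₊ : ℝ) / 2 ^ n) • x) atTop (𝓝 (r • x)) :=
    ((tendsto_nat_floor_mul_div_atTop hr).comp
      (tendsto_pow_atTop_atTop_of_one_lt (one_lt_two : (1 : ℝ) < 2))).smul_const x
  refine ge_of_tendsto' hlim fun n => nonneg_of_two_pow_nsmul_nonneg n ?_
  have : (2 ^ n : ℕ) • (((⌊r * 2 ^ n⌋₊ : ℝ) / 2 ^ n) • x) = ⌊r * 2 ^ n⌋₊ • x := by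
    rw [← Nat.cast_smul_eq_nsmul ℝ, ← Nat.cast_smul_eq_nsmul ℝ, smul_smul]
    push_cast
    rw [mul_div_cancel₀ _ (by positivity)]
  rw [this]
  exact nsmul_nonneg hx _

theorem smul_inf_smul_eq_zero {x y : E} (hx : 0 ≤ x) (hy : 0 ≤ y) (h : x ⊓ y = 0)
    {c d : ℝ} (hc : 0 ≤ c) (hd : 0 ≤ d) : c • x ⊓ d • y = 0 := by
  have hz : 0 ≤ c • x ⊓ d • y :=
    le_inf (smul_nonneg_of_hasSolidNorm hc hx) (smul_nonneg_of_hasSolidNorm hd hy)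
  have hK : 0 < c + d + 1 := by positivity
  have mono : ∀ {r s : ℝ} {w : E}, 0 ≤ w → r ≤ s → r • w ≤ s • w := fun {r s w} hw hrs => by
    rw [← sub_nonneg, ← sub_smul]
    exact smul_nonneg_of_hasSolidNorm (sub_nonneg.2 hrs) hw
  have key : ∀ {w : E}, c • x ⊓ d • y ≤ (c + d + 1) • w → (c + d + 1)⁻¹ • (c • x ⊓ d • y) ≤ w :=
    fun {w} hw => by
      have := smul_nonneg_of_hasSolidNorm (inv_nonneg.2 hK.le) (sub_nonneg.2 hw)
      rwa [smul_sub, smul_smul, inv_mul_cancel₀ hK.ne', one_smul, sub_nonneg] at this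
  have hle : (c + d + 1)⁻¹ • (c • x ⊓ d • y) ≤ x ⊓ y :=
    le_inf (key (inf_le_left.trans (mono hx (by linarith))))
      (key (inf_le_right.trans (mono hy (by linarith))))
  have h0 : (c + d + 1)⁻¹ • (c • x ⊓ d • y) = 0 :=
    le_antisymm (hle.trans h.le) (smul_nonneg_of_hasSolidNorm (inv_nonneg.2 hK.le) hz)
  exact (smul_eq_zero.1 h0).resolve_left (inv_ne_zero hK.ne')

theorem abs_sum_smul_of_disjoint {ι : Type*} (s : Finset ι) (x : ι → E) (hx : ∀ i, 0 ≤ x i)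
    (hd : ∀ i j, i ≠ j → x i ⊓ x j = 0) (c : ι → ℝ) :
    |∑ i ∈ s, c i • x i| = ∑ i ∈ s, |c i| • x i := by
  have hpos : ∀ i, 0 ≤ (c i)⁺ • x i := fun i =>
    smul_nonneg_of_hasSolidNorm (posPart_nonneg _) (hx i)
  have hneg : ∀ i, 0 ≤ (c i)⁻ • x i := fun i =>
    smul_nonneg_of_hasSolidNorm (negPart_nonneg _) (hx i)
  have hdis : (∑ i ∈ s, (c i)⁺ • x i) ⊓ (∑ i ∈ s, (c i)⁻ • x i) = 0 := by
    refine inf_sum_eq_zero s (Finset.sum_nonneg fun i _ => hpos i) _ (fun i _ => hneg i) ?_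
    intro i _
    rw [inf_comm]
    refine inf_sum_eq_zero s (hneg i) _ (fun j _ => hpos j) ?_
    intro j _
    by_cases hij : i = j
    · subst hij
      rcases le_total 0 (c i) with h | h
      · rw [negPart_eq_zero.2 h, zero_smul, inf_eq_left]
        exact hpos i
      · rw [posPart_eq_zero.2 h, zero_smul, inf_eq_right]
        exact hneg i
    · exact smul_inf_smul_eq_zero (hx i) (hx j) (hd i j hij) (negPart_nonneg _) (posPart_nonneg _)
  have h1 : ∑ i ∈ s, c i • x i = ∑ i ∈ s, (c i)⁺ • x i - ∑ i ∈ s, (c i)⁻ • x i := by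
    rw [← Finset.sum_sub_distrib]
    exact Finset.sum_congr rfl fun i _ => by rw [← sub_smul, posPart_sub_negPart]
  have h2 : ∑ i ∈ s, |c i| • x i = ∑ i ∈ s, (c i)⁺ • x i + ∑ i ∈ s, (c i)⁻ • x i := by
    rw [← Finset.sum_add_distrib]
    exact Finset.sum_congr rfl fun i _ => by rw [← add_smul, posPart_add_negPart]
  rw [h1, h2, ← inf_add_sup, hdis, zero_add, ← sup_sub_inf_eq_abs_sub, inf_comm, hdis, sub_zero,
    sup_comm]

theorem abs_sum_le_sum_abs_of_lattice {ι : Type*} (s : Finset ι) (x : ι → E) :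
    |∑ i ∈ s, x i| ≤ ∑ i ∈ s, |x i| :=
  Finset.le_sum_of_subadditive _ abs_zero.le abs_add_le s x

theorem norm_le_of_dualLe {f g : E →L[ℝ] ℝ} (hf : dualLe 0 f) (hfg : dualLe f g) :
    ‖f‖ ≤ ‖g‖ := by
  refine f.opNorm_le_bound (norm_nonneg _) fun y => ?_
  have h0 : ∀ z : E, 0 ≤ z → 0 ≤ f z := fun z hz => hf z hz
  have h1 := h0 _ (sub_nonneg.2 (le_abs_self y))
  have h2 := h0 _ (sub_nonneg.2 (neg_le_abs y))
  rw [map_sub] at h1 h2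
  rw [map_neg] at h2
  calc ‖f y‖ ≤ f |y| := by rw [Real.norm_eq_abs, abs_le]; constructor <;> linarith
    _ ≤ g |y| := hfg _ (abs_nonneg y)
    _ ≤ ‖g |y|‖ := le_abs_self _
    _ ≤ ‖g‖ * ‖|y|‖ := g.le_opNorm _
    _ = ‖g‖ * ‖y‖ := by rw [norm_abs_eq_norm]

/-- The values of the modulus of a functional on the positive cone. -/
noncomputable def coneModulus (ξ : E →L[ℝ] ℝ) (y : E) : ℝ := sSup (ξ '' {z | |z| ≤ y})

theorem apply_le_of_abs_le (ξ : E →L[ℝ] ℝ) {y z : E} (h : |z| ≤ y) : ξ z ≤ ‖ξ‖ * ‖y‖ :=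
  (le_abs_self _).trans ((ξ.le_opNorm z).trans
    (mul_le_mul_of_nonneg_left (norm_le_norm_of_abs_le_abs (h.trans (le_abs_self y)))
      (norm_nonneg _)))

theorem le_coneModulus (ξ : E →L[ℝ] ℝ) {y z : E} (h : |z| ≤ y) : ξ z ≤ coneModulus ξ y :=
  le_csSup ⟨‖ξ‖ * ‖y‖, by rintro _ ⟨w, hw, rfl⟩; exact apply_le_of_abs_le ξ hw⟩ ⟨z, h, rfl⟩

theorem coneModulus_le (ξ : E →L[ℝ] ℝ) {y : E} (hy : 0 ≤ y) {r : ℝ}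
    (h : ∀ z, |z| ≤ y → ξ z ≤ r) : coneModulus ξ y ≤ r :=
  csSup_le ⟨ξ 0, 0, by simpa using hy, rfl⟩ (by rintro _ ⟨w, hw, rfl⟩; exact h w hw)

theorem coneModulus_nonneg (ξ : E →L[ℝ] ℝ) {y : E} (hy : 0 ≤ y) : 0 ≤ coneModulus ξ y := by
  simpa using le_coneModulus ξ (y := y) (z := 0) (by simpa using hy)

theorem coneModulus_add (ξ : E →L[ℝ] ℝ) {y z : E} (hy : 0 ≤ y) (hz : 0 ≤ z) :
    coneModulus ξ (y + z) = coneModulus ξ y + coneModulus ξ z := by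
  apply le_antisymm
  · refine coneModulus_le ξ (add_nonneg hy hz) fun w hw => ?_
    obtain ⟨hw1, hw2⟩ := abs_le'.1 hw
    have e1 : |(w ⊓ y) ⊔ (-y)| ≤ y := by
      refine abs_le'.2 ⟨sup_le inf_le_right ((neg_nonpos.2 hy).trans hy), ?_⟩
      exact neg_le.1 le_sup_right
    have e2 : |w - ((w ⊓ y) ⊔ (-y))| ≤ z := by
      refine abs_le'.2 ⟨?_, ?_⟩
      · rw [sub_le_comm]
        refine le_sup_of_le_left (le_inf (sub_le_self _ hz) ?_)
        rwa [sub_le_iff_le_add]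
      · rw [neg_sub, sub_le_iff_le_add]
        refine sup_le (inf_le_left.trans (le_add_of_nonneg_left hz)) ?_
        rw [← sub_nonneg] at hw2 ⊢
        convert hw2 using 1
        abel
    have := add_le_add (le_coneModulus ξ e1) (le_coneModulus ξ e2)
    rwa [← map_add, add_sub_cancel] at this
  · rw [← le_sub_iff_add_le]
    refine coneModulus_le ξ hy fun u hu => ?_
    rw [le_sub_comm]
    refine coneModulus_le ξ hz fun w hw => ?_
    rw [le_sub_iff_add_le', ← map_add]
    exact le_coneModulus ξ ((abs_add_le u w).trans (add_le_add hu hw))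

/-- Every functional on a Banach lattice has a modulus, of no larger norm. -/
theorem exists_dual_modulus (ξ : E →L[ℝ] ℝ) :
    ∃ η : E →L[ℝ] ℝ, dualLe ξ η ∧ dualLe (-ξ) η ∧ ‖η‖ ≤ ‖ξ‖ ∧
      ∀ ψ : E →L[ℝ] ℝ, dualLe ξ ψ → dualLe (-ξ) ψ → dualLe η ψ := by
  have hsub : ∀ a b : E, 0 ≤ a → 0 ≤ b →
      coneModulus ξ (a - b)⁺ - coneModulus ξ (a - b)⁻ = coneModulus ξ a - coneModulus ξ b := by
    intro a b ha hb
    have h : (a - b)⁺ + b = a + (a - b)⁻ := by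
      have := posPart_sub_negPart (a - b)
      rw [sub_eq_iff_eq_add] at this
      rw [this]; abel
    have := congrArg (coneModulus ξ) h
    rw [coneModulus_add ξ (posPart_nonneg _) hb, coneModulus_add ξ ha (negPart_nonneg _)] at this
    linarith
  let f : E →+ ℝ :=
    { toFun := fun y => coneModulus ξ y⁺ - coneModulus ξ y⁻
      map_zero' := by simp
      map_add' := fun y z => by
        have h : y + z = (y⁺ + z⁺) - (y⁻ + z⁻) := by
          rw [add_sub_add_comm, posPart_sub_negPart, posPart_sub_negPart]
        have := hsub (y⁺ + z⁺) (y⁻ + z⁻) (add_nonneg (posPart_nonneg _) (posPart_nonneg _))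
          (add_nonneg (negPart_nonneg _) (negPart_nonneg _))
        rw [← h, coneModulus_add ξ (posPart_nonneg _) (posPart_nonneg _),
          coneModulus_add ξ (negPart_nonneg _) (negPart_nonneg _)] at this
        rw [this]; ring }
  have hbound : ∀ y, ‖f y‖ ≤ ‖ξ‖ * ‖y‖ := by
    intro y
    have h1 := coneModulus_nonneg ξ (posPart_nonneg y)
    have h2 := coneModulus_nonneg ξ (negPart_nonneg y)
    have h3 : coneModulus ξ y⁺ + coneModulus ξ y⁻ ≤ ‖ξ‖ * ‖y‖ := by
      rw [← coneModulus_add ξ (posPart_nonneg _) (negPart_nonneg _), posPart_add_negPart,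
        ← norm_abs_eq_norm y]
      exact coneModulus_le ξ (abs_nonneg y) fun z hz => apply_le_of_abs_le ξ hz
    change |coneModulus ξ y⁺ - coneModulus ξ y⁻| ≤ _
    rw [abs_le]
    constructor <;> linarith
  have hcont : Continuous f := AddMonoidHomClass.continuous_of_bound f ‖ξ‖ hbound
  have hcone : ∀ y, 0 ≤ y → f.toRealLinearMap hcont y = coneModulus ξ y := by
    intro y hy
    change coneModulus ξ y⁺ - coneModulus ξ y⁻ = _
    have := hsub y 0 hy le_rfl
    rw [sub_zero] at this
    rw [this, sub_eq_self]
    refine le_antisymm (coneModulus_le ξ le_rfl fun z hz => ?_) (coneModulus_nonneg ξ le_rfl)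
    simpa using apply_le_of_abs_le ξ hz
  refine ⟨f.toRealLinearMap hcont, fun y hy => ?_, fun y hy => ?_,
    ContinuousLinearMap.opNorm_le_bound _ (norm_nonneg _) hbound, fun ψ h1 h2 y hy => ?_⟩
  · rw [hcone y hy]
    exact le_coneModulus ξ (abs_of_nonneg hy).le
  · rw [hcone y hy, neg_apply, ← map_neg]
    exact le_coneModulus ξ (by rw [abs_neg, abs_of_nonneg hy])
  · rw [hcone y hy]
    refine coneModulus_le ξ hy fun z hz => ?_
    have a1 := h1 _ (posPart_nonneg z)
    have a2 := h2 _ (negPart_nonneg z)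
    have a3 : ξ z = ξ z⁺ - ξ z⁻ := by rw [← map_sub, posPart_sub_negPart]
    have a4 : ψ |z| = ψ z⁺ + ψ z⁻ := by rw [← map_add, posPart_add_negPart]
    have a5 : 0 ≤ ψ (y - |z|) := by
      have b1 := h1 _ (sub_nonneg.2 hz)
      have b2 := h2 _ (sub_nonneg.2 hz)
      rw [neg_apply] at b2
      linarith
    rw [map_sub] at a5
    rw [neg_apply] at a2
    linarith

end OrderedSpace

section RegularOperators

variable {X : Type*} [NormedAddCommGroup X] [Lattice X] [HasSolidNorm X] [IsOrderedAddMonoid X]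
  [NormedSpace ℝ X]

theorem IsPosOp.mono {S : X →L[ℝ] X} (hS : IsPosOp S) {x y : X} (h : x ≤ y) : S x ≤ S y := by
  have := hS _ (sub_nonneg.2 h)
  rwa [map_sub, sub_nonneg] at this

theorem IsPosOp.comp {S T : X →L[ℝ] X} (hS : IsPosOp S) (hT : IsPosOp T) : IsPosOp (S * T) :=
  fun x hx => hS _ (hT x hx)

theorem isPosOp_one : IsPosOp (1 : X →L[ℝ] X) := fun _ hx => hx

theorem IsPosOp.sum {ι : Type*} (s : Finset ι) {S : ι → X →L[ℝ] X} (h : ∀ i, IsPosOp (S i)) :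
    IsPosOp (∑ i ∈ s, S i) := fun x hx => by
  rw [sum_apply]
  exact Finset.sum_nonneg fun i _ => h i x hx

theorem IsPosOp.mem_LrSet {S : X →L[ℝ] X} (hS : IsPosOp S) : S ∈ LrSet X :=
  ⟨1, fun _ => 1, fun _ => S, fun _ => hS, by simp⟩

theorem mem_LrSet_iff_mem_span {T : X →L[ℝ] X} :
    T ∈ LrSet X ↔ T ∈ Submodule.span ℝ {S : X →L[ℝ] X | IsPosOp S} := by
  rw [Submodule.mem_span_set']
  constructor
  · rintro ⟨n, c, S, hS, rfl⟩
    exact ⟨n, c, fun i => ⟨S i, hS i⟩, rfl⟩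
  · rintro ⟨n, c, S, rfl⟩
    exact ⟨n, c, fun i => S i, fun i => (S i).2, rfl⟩

variable (X) in
/-- The algebra of regular operators. -/
def lrAlgebra : Subalgebra ℝ (X →L[ℝ] X) where
  carrier := LrSet X
  add_mem' {a b} ha hb := by
    rw [mem_LrSet_iff_mem_span] at *
    exact add_mem ha hb
  mul_mem' {a b} ha hb := by
    rw [mem_LrSet_iff_mem_span] at *
    have := Submodule.mul_mem_mul ha hb
    rw [Submodule.span_mul_span] at this
    refine Submodule.span_mono ?_ this
    rintro _ ⟨S, hS, T, hT, rfl⟩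
    exact IsPosOp.comp hS hT
  algebraMap_mem' r := by
    rw [mem_LrSet_iff_mem_span, Algebra.algebraMap_eq_smul_one]
    exact Submodule.smul_mem _ _ (Submodule.subset_span isPosOp_one)

theorem lrAlgebra_induction {p : lrAlgebra X → Prop} (pos : ∀ T : lrAlgebra X, IsPosOp T.1 → p T)
    (add : ∀ S T, p S → p T → p (S + T)) (smul : ∀ (c : ℝ) T, p T → p (c • T))
    (T : lrAlgebra X) : p T := by
  obtain ⟨T, n, c, S, hS, rfl⟩ := T
  have h0 : p 0 := pos 0 fun x _ => le_rfl
  have : (⟨∑ i, c i • S i, n, c, S, hS, rfl⟩ : lrAlgebra X) =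
      ∑ i, c i • (⟨S i, (hS i).mem_LrSet⟩ : lrAlgebra X) := by
    ext1
    simp
  rw [this]
  exact Finset.sum_induction _ p add h0 fun i _ => smul _ _ (pos _ (hS i))

/-- The operator `S` dominates the operator `T`. -/
def DominatedBy (T S : X →L[ℝ] X) : Prop := ∀ x : X, |T x| ≤ S |x|

theorem IsPosOp.dominatedBy {S : X →L[ℝ] X} (hS : IsPosOp S) : DominatedBy S S := fun x => by
  refine abs_le'.2 ⟨hS.mono (le_abs_self x), ?_⟩
  rw [← map_neg]
  exact hS.mono (neg_le_abs x)

theorem DominatedBy.mul {T₁ T₂ S₁ S₂ : X →L[ℝ] X} (h₁ : DominatedBy T₁ S₁)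
    (h₂ : DominatedBy T₂ S₂) (hS₁ : IsPosOp S₁) : DominatedBy (T₁ * T₂) (S₁ * S₂) := fun x =>
  (h₁ (T₂ x)).trans (hS₁.mono (h₂ x))

theorem dominatedBy_sum_sign {ι : Type*} (s : Finset ι) {S : ι → X →L[ℝ] X}
    (hS : ∀ i, IsPosOp (S i)) {ε : ι → ℝ} (hε : ∀ i, ε i = 1 ∨ ε i = -1) :
    DominatedBy (∑ i ∈ s, ε i • S i) (∑ i ∈ s, S i) := fun x => by
  rw [sum_apply, sum_apply]
  refine (abs_sum_le_sum_abs_of_lattice s _).trans (Finset.sum_le_sum fun i _ => ?_)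
  have : |(ε i • S i) x| = |S i x| := by
    rcases hε i with h | h <;> simp [h]
  rw [this]
  exact (hS i).dominatedBy x

theorem DominatedBy.rnorm_le {T S : X →L[ℝ] X} (h : DominatedBy T S) : rnorm T ≤ ‖S‖ :=
  csInf_le ⟨0, by rintro _ ⟨S, rfl, -⟩; exact norm_nonneg S⟩ ⟨S, rfl, h⟩

theorem DominatedBy.norm_le {T S : X →L[ℝ] X} (h : DominatedBy T S) : ‖T‖ ≤ ‖S‖ :=
  T.opNorm_le_bound (norm_nonneg _) fun x => by
    rw [← norm_abs_eq_norm x]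
    exact (norm_le_norm_of_abs_le_abs ((h x).trans (le_abs_self _))).trans (S.le_opNorm _)

theorem rnorm_nonneg (T : X →L[ℝ] X) : 0 ≤ rnorm T :=
  Real.sInf_nonneg (by rintro _ ⟨S, rfl, -⟩; exact norm_nonneg S)

end RegularOperators

section SignAveraging

variable {W : Type*} [NormedAddCommGroup W] [NormedSpace ℝ W]

theorem norm_add_sum_diag_le {ι : Type*} (s : Finset ι) (v : ι → ι → W) (K : ℝ) (c : W)
    (h : ∀ ε : ι → ℝ, (∀ i, ε i = 1 ∨ ε i = -1) →
      ‖c + ∑ i ∈ s, ∑ j ∈ s, (ε i * ε j) • v i j‖ ≤ K) :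
    ‖c + ∑ i ∈ s, v i i‖ ≤ K := by
  classical
  induction s using Finset.induction_on generalizing c with
  | empty => simpa using h (fun _ => 1) fun _ => Or.inl rfl
  | insert a s ha ih =>
    rw [Finset.sum_insert ha, ← add_assoc]
    refine ih _ fun ε hε => ?_
    have expand : ∀ r : ℝ, r * r = 1 →
        c + ∑ i ∈ insert a s, ∑ j ∈ insert a s,
          (Function.update ε a r i * Function.update ε a r j) • v i j =
        (c + v a a + ∑ i ∈ s, ∑ j ∈ s, (ε i * ε j) • v i j) +
          r • (∑ j ∈ s, ε j • v a j + ∑ i ∈ s, ε i • v i a) := by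
      intro r hr
      have hu : ∀ i ∈ s, Function.update ε a r i = ε i := fun i hi =>
        Function.update_of_ne (by rintro rfl; exact ha hi) _ _
      have e1 : ∑ j ∈ s, (Function.update ε a r a * Function.update ε a r j) • v a j =
          r • ∑ j ∈ s, ε j • v a j := by
        rw [Finset.smul_sum]
        exact Finset.sum_congr rfl fun j hj => by rw [hu j hj, Function.update_self, smul_smul]
      have e2 : ∑ i ∈ s, ∑ j ∈ insert a s,
          (Function.update ε a r i * Function.update ε a r j) • v i j =
          r • ∑ i ∈ s, ε i • v i a + ∑ i ∈ s, ∑ j ∈ s, (ε i * ε j) • v i j := by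
        rw [Finset.smul_sum, ← Finset.sum_add_distrib]
        refine Finset.sum_congr rfl fun i hi => ?_
        rw [Finset.sum_insert ha, hu i hi, Function.update_self, smul_smul, mul_comm]
        congr 1
        exact Finset.sum_congr rfl fun j hj => by rw [hu j hj]
      rw [Finset.sum_insert ha, Finset.sum_insert ha, e1, e2, Function.update_self, hr, one_smul,
        smul_add]
      abel
    have sign : ∀ r : ℝ, (r = 1 ∨ r = -1) →
        ∀ i, Function.update ε a r i = 1 ∨ Function.update ε a r i = -1 := by
      intro r hr i
      by_cases hi : i = a
      · subst hi; simpa using hr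
      · simpa [Function.update_of_ne hi] using hε i
    have h1 := h _ (sign 1 (Or.inl rfl))
    have h2 := h _ (sign (-1) (Or.inr rfl))
    rw [expand _ (by norm_num)] at h1 h2
    set A := c + v a a + ∑ i ∈ s, ∑ j ∈ s, (ε i * ε j) • v i j
    set B := ∑ j ∈ s, ε j • v a j + ∑ i ∈ s, ε i • v i a
    have h3 : (2 : ℝ) • A = (A + (1 : ℝ) • B) + (A + (-1 : ℝ) • B) := by
      rw [two_smul, one_smul, neg_one_smul]; abel
    have h4 := norm_add_le (A + (1 : ℝ) • B) (A + (-1 : ℝ) • B)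
    rw [← h3, norm_smul, Real.norm_ofNat] at h4
    linarith

theorem norm_sum_diag_le {ι V : Type*} [AddCommGroup V] [Module ℝ V]
    (β : V →ₗ[ℝ] V →ₗ[ℝ] W) (s : Finset ι) (p : ι → V) (K : ℝ)
    (h : ∀ ε : ι → ℝ, (∀ i, ε i = 1 ∨ ε i = -1) →
      ‖β (∑ i ∈ s, ε i • p i) (∑ i ∈ s, ε i • p i)‖ ≤ K) :
    ‖∑ i ∈ s, β (p i) (p i)‖ ≤ K := by
  have := norm_add_sum_diag_le s (fun i j => β (p i) (p j)) K 0 fun ε hε => by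
    convert h ε hε using 2
    simp only [map_sum, map_smul, LinearMap.sum_apply, LinearMap.smul_apply, zero_add,
      Finset.smul_sum, smul_smul]
    rw [Finset.sum_comm]
    exact Finset.sum_congr rfl fun i _ => Finset.sum_congr rfl fun j _ => by rw [mul_comm]
  simpa using this

end SignAveraging

section Bimodule

variable {X 𝔛 : Type*} [NormedAddCommGroup X] [Lattice X] [HasSolidNorm X] [IsOrderedAddMonoid X]
  [NormedSpace ℝ X] [NormedAddCommGroup 𝔛] [Lattice 𝔛] [HasSolidNorm 𝔛] [IsOrderedAddMonoid 𝔛]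
  [NormedSpace ℝ 𝔛]

/-- A bimodule structure on the dual of `𝔛` over the regular operators, for which both actions are
positive and bounded, together with a bounded derivation into it. -/
structure IsBoundedDerivation
    (Λ ρ : lrAlgebra X →ₗ[ℝ] (𝔛 →L[ℝ] ℝ) →ₗ[ℝ] (𝔛 →L[ℝ] ℝ))
    (δ : lrAlgebra X →ₗ[ℝ] (𝔛 →L[ℝ] ℝ)) (K : ℝ) : Prop where
  nonneg : 0 ≤ K
  left_mul : ∀ a b ξ, Λ (a * b) ξ = Λ a (Λ b ξ)
  right_mul : ∀ a b ξ, ρ (a * b) ξ = ρ b (ρ a ξ)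
  comm : ∀ a b ξ, Λ a (ρ b ξ) = ρ b (Λ a ξ)
  left_pos : ∀ a, IsPosOp a.1 → ∀ ξ, dualLe 0 ξ → dualLe 0 (Λ a ξ)
  right_pos : ∀ a, IsPosOp a.1 → ∀ ξ, dualLe 0 ξ → dualLe 0 (ρ a ξ)
  left_bound : ∀ a S, DominatedBy a.1 S → ∀ ξ, ‖Λ a ξ‖ ≤ K * ‖S‖ * ‖ξ‖
  right_bound : ∀ a S, DominatedBy a.1 S → ∀ ξ, ‖ρ a ξ‖ ≤ K * ‖S‖ * ‖ξ‖
  leibniz : ∀ a b, δ (a * b) = Λ a (δ b) + ρ b (δ a)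
  bound : ∀ a S, DominatedBy a.1 S → ‖δ a‖ ≤ K * ‖S‖

/-- A map on the regular operators is majorized with constant `C` if it lies below a positive
linear map which is bounded by `C` on positive operators. -/
def IsMajorized (C : ℝ) (R : lrAlgebra X → (𝔛 →L[ℝ] ℝ)) : Prop :=
  ∃ P : lrAlgebra X →ₗ[ℝ] (𝔛 →L[ℝ] ℝ), ∀ T : lrAlgebra X, IsPosOp T.1 →
    dualLe 0 (P T) ∧ dualLe (R T) (P T) ∧ ‖P T‖ ≤ C * ‖T.1‖

/-- The modulus of a functional. -/
noncomputable def dualModulus (ξ : 𝔛 →L[ℝ] ℝ) : 𝔛 →L[ℝ] ℝ := (exists_dual_modulus ξ).choose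

theorem le_dualModulus (ξ : 𝔛 →L[ℝ] ℝ) : dualLe ξ (dualModulus ξ) :=
  (exists_dual_modulus ξ).choose_spec.1

theorem neg_le_dualModulus (ξ : 𝔛 →L[ℝ] ℝ) : dualLe (-ξ) (dualModulus ξ) :=
  (exists_dual_modulus ξ).choose_spec.2.1

theorem norm_dualModulus_le (ξ : 𝔛 →L[ℝ] ℝ) : ‖dualModulus ξ‖ ≤ ‖ξ‖ :=
  (exists_dual_modulus ξ).choose_spec.2.2.1

theorem dualModulus_le {ξ ψ : 𝔛 →L[ℝ] ℝ} (h₁ : dualLe ξ ψ) (h₂ : dualLe (-ξ) ψ) :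
    dualLe (dualModulus ξ) ψ :=
  (exists_dual_modulus ξ).choose_spec.2.2.2 ψ h₁ h₂

theorem dualModulus_nonneg (ξ : 𝔛 →L[ℝ] ℝ) : dualLe 0 (dualModulus ξ) := fun y hy => by
  have h₁ := le_dualModulus ξ y hy
  have h₂ := neg_le_dualModulus ξ y hy
  rw [neg_apply] at h₂
  rw [zero_apply]
  linarith

theorem smul_dualModulus_le {ξ ψ : 𝔛 →L[ℝ] ℝ} {t : ℝ} (ht : 0 ≤ t) (hψ : dualLe 0 ψ)
    (h₁ : dualLe (t • ξ) ψ) (h₂ : dualLe (-(t • ξ)) ψ) : dualLe (t • dualModulus ξ) ψ := by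
  rcases ht.eq_or_lt with rfl | ht
  · rwa [zero_smul]
  have key : ∀ {θ : 𝔛 →L[ℝ] ℝ}, dualLe (t • θ) ψ → dualLe θ (t⁻¹ • ψ) := by
    intro θ h y hy
    rw [smul_apply, smul_eq_mul, ← div_eq_inv_mul, le_div_iff₀' ht]
    exact h y hy
  intro y hy
  have := dualModulus_le (key h₁) (key (by rwa [smul_neg])) y hy
  rw [smul_apply, smul_eq_mul, ← div_eq_inv_mul, le_div_iff₀' ht] at this
  exact this

theorem dualLe.map {L : (𝔛 →L[ℝ] ℝ) →ₗ[ℝ] (𝔛 →L[ℝ] ℝ)}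
    (hL : ∀ ξ, dualLe 0 ξ → dualLe 0 (L ξ)) {ξ ψ : 𝔛 →L[ℝ] ℝ} (h : dualLe ξ ψ) :
    dualLe (L ξ) (L ψ) := fun y hy => by
  have := hL (ψ - ξ) (fun y hy => by simpa using h y hy) y hy
  simpa using this

namespace IsBoundedDerivation

variable {Λ ρ : lrAlgebra X →ₗ[ℝ] (𝔛 →L[ℝ] ℝ) →ₗ[ℝ] (𝔛 →L[ℝ] ℝ)}
  {δ : lrAlgebra X →ₗ[ℝ] (𝔛 →L[ℝ] ℝ)} {K : ℝ}

theorem norm_left_le (h : IsBoundedDerivation Λ ρ δ K) {a : lrAlgebra X} {S : X →L[ℝ] X}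
    (ha : DominatedBy a.1 S) {C B : ℝ} (hS : ‖S‖ ≤ C) {ξ : 𝔛 →L[ℝ] ℝ} (hξ : ‖ξ‖ ≤ B) :
    ‖Λ a ξ‖ ≤ K * C * B :=
  (h.left_bound a S ha ξ).trans (mul_le_mul (mul_le_mul_of_nonneg_left hS h.nonneg) hξ
    (norm_nonneg _) (mul_nonneg h.nonneg ((norm_nonneg _).trans hS)))

theorem norm_right_le (h : IsBoundedDerivation Λ ρ δ K) {a : lrAlgebra X} {S : X →L[ℝ] X}
    (ha : DominatedBy a.1 S) {C B : ℝ} (hS : ‖S‖ ≤ C) {ξ : 𝔛 →L[ℝ] ℝ} (hξ : ‖ξ‖ ≤ B) :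
    ‖ρ a ξ‖ ≤ K * C * B :=
  (h.right_bound a S ha ξ).trans (mul_le_mul (mul_le_mul_of_nonneg_left hS h.nonneg) hξ
    (norm_nonneg _) (mul_nonneg h.nonneg ((norm_nonneg _).trans hS)))

theorem norm_le (h : IsBoundedDerivation Λ ρ δ K) {a : lrAlgebra X} {S : X →L[ℝ] X}
    (ha : DominatedBy a.1 S) {C : ℝ} (hS : ‖S‖ ≤ C) : ‖δ a‖ ≤ K * C :=
  (h.bound a S ha).trans (mul_le_mul_of_nonneg_left hS h.nonneg)

theorem dominatedBy_sum_sign_coe (s : Finset ℕ) {p : ℕ → lrAlgebra X}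
    (hp : ∀ i, IsPosOp (p i).1) {ε : ℕ → ℝ} (hε : ∀ i, ε i = 1 ∨ ε i = -1) :
    DominatedBy (∑ i ∈ s, ε i • p i : lrAlgebra X).1 (∑ i ∈ s, p i : lrAlgebra X).1 := by
  have := dominatedBy_sum_sign s hp hε
  convert this using 1 <;> simp

theorem isPosOp_sum_coe (s : Finset ℕ) {p : ℕ → lrAlgebra X} (hp : ∀ i, IsPosOp (p i).1) :
    IsPosOp (∑ i ∈ s, p i : lrAlgebra X).1 := by
  have := IsPosOp.sum s hp
  convert this using 1
  simp

theorem norm_sum_left_le (h : IsBoundedDerivation Λ ρ δ K) (s : Finset ℕ) {p : ℕ → lrAlgebra X}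
    (hp : ∀ i, IsPosOp (p i).1) {C : ℝ} (hC : ‖(∑ i ∈ s, p i : lrAlgebra X).1‖ ≤ C) :
    ‖∑ i ∈ s, Λ (p i) (δ (p i))‖ ≤ K * C * (K * C) :=
  norm_sum_diag_le (Λ.compl₂ δ) s p _ fun _ hε =>
    h.norm_left_le (dominatedBy_sum_sign_coe s hp hε) hC
      (h.norm_le (dominatedBy_sum_sign_coe s hp hε) hC)

theorem norm_sum_right_le (h : IsBoundedDerivation Λ ρ δ K) (s : Finset ℕ) {p : ℕ → lrAlgebra X}
    (hp : ∀ i, IsPosOp (p i).1) {C : ℝ} (hC : ‖(∑ i ∈ s, p i : lrAlgebra X).1‖ ≤ C) :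
    ‖∑ i ∈ s, ρ (p i) (δ (p i))‖ ≤ K * C * (K * C) :=
  norm_sum_diag_le (ρ.compl₂ δ) s p _ fun _ hε =>
    h.norm_right_le (dominatedBy_sum_sign_coe s hp hε) hC
      (h.norm_le (dominatedBy_sum_sign_coe s hp hε) hC)

theorem norm_sum_sum_le (h : IsBoundedDerivation Λ ρ δ K) (s t : Finset ℕ) {p q : ℕ → lrAlgebra X}
    (hp : ∀ i, IsPosOp (p i).1) (hq : ∀ i, IsPosOp (q i).1) {C : ℝ}
    (hCp : ‖(∑ i ∈ s, p i : lrAlgebra X).1‖ ≤ C) (hCq : ‖(∑ i ∈ t, q i : lrAlgebra X).1‖ ≤ C)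
    {T : lrAlgebra X} (hT : IsPosOp T.1) :
    ‖∑ i ∈ s, ∑ j ∈ t, Λ (p i) (ρ (q j) (δ (p i * T * q j)))‖ ≤
      K * C * (K * C * (K * (C * ‖T.1‖ * C))) := by
  rw [Finset.sum_comm]
  let β : lrAlgebra X →ₗ[ℝ] lrAlgebra X →ₗ[ℝ] (𝔛 →L[ℝ] ℝ) :=
    LinearMap.mk₂ ℝ (fun a b => ∑ i ∈ s, Λ (p i) (ρ a (δ (p i * T * b))))
      (by intros; simp [Finset.sum_add_distrib]) (by intros; simp [Finset.smul_sum])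
      (by intros; simp [Finset.sum_add_distrib, mul_add]) (by intros; simp [Finset.smul_sum])
  refine norm_sum_diag_le β t q _ fun ε hε => ?_
  set g := ∑ j ∈ t, ε j • q j
  have hg : DominatedBy g.1 (∑ j ∈ t, q j : lrAlgebra X).1 := dominatedBy_sum_sign_coe t hq hε
  let γ : lrAlgebra X →ₗ[ℝ] lrAlgebra X →ₗ[ℝ] (𝔛 →L[ℝ] ℝ) :=
    LinearMap.mk₂ ℝ (fun a b => Λ a (ρ g (δ (b * T * g))))
      (by intros; simp) (by intros; simp) (by intros; simp [add_mul]) (by intros; simp)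
  refine norm_sum_diag_le γ s p _ fun ε' hε' => ?_
  set f := ∑ i ∈ s, ε' i • p i
  have hf : DominatedBy f.1 (∑ j ∈ s, p j : lrAlgebra X).1 := dominatedBy_sum_sign_coe s hp hε'
  have hC : 0 ≤ C := (norm_nonneg _).trans hCp
  refine h.norm_left_le hf hCp (h.norm_right_le hg hCq (h.norm_le
    ((hf.mul hT.dominatedBy (isPosOp_sum_coe s hp)).mul hg
      ((isPosOp_sum_coe s hp).comp hT)) ?_))
  refine (norm_mul_le _ _).trans (mul_le_mul ((norm_mul_le _ _).trans
    (mul_le_mul_of_nonneg_right hCp (norm_nonneg _))) hCq (norm_nonneg _) (by positivity))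

/-- The compression of a derivation by two finite sums of one-dimensional disjoint band projections
is majorized, with a constant depending only on the norms of the sums. -/
theorem isMajorized_compress (h : IsBoundedDerivation Λ ρ δ K) (s t : Finset ℕ)
    {p q : ℕ → lrAlgebra X} {E : ℕ → ℕ → lrAlgebra X} {τ : ℕ → ℕ → lrAlgebra X →ₗ[ℝ] ℝ}
    (hp : ∀ i, IsPosOp (p i).1) (hq : ∀ i, IsPosOp (q i).1)
    (hpp : ∀ i j, p i * p j = if i = j then p i else 0)
    (hqq : ∀ i j, q i * q j = if i = j then q i else 0)
    (hE : ∀ i j T, p i * T * q j = τ i j T • E i j)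
    (hτ : ∀ i j T, IsPosOp T.1 → 0 ≤ τ i j T) {C : ℝ}
    (hCp : ‖(∑ i ∈ s, p i : lrAlgebra X).1‖ ≤ C) (hCq : ‖(∑ i ∈ t, q i : lrAlgebra X).1‖ ≤ C) :
    IsMajorized (K * C * (K * C * (K * C * (K * C * (K * (C * C))))) +
        K * C * (K * C * (K * C)) + K * C * (K * C * (K * C)))
      (fun T => Λ (∑ i ∈ s, p i) (ρ (∑ j ∈ t, q j) (δ T))) := by
  have hK := h.nonneg
  have hC : 0 ≤ C := (norm_nonneg _).trans hCp
  set e := ∑ i ∈ s, p i with he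
  set f := ∑ j ∈ t, q j with hf
  have hepos : IsPosOp e.1 := isPosOp_sum_coe s hp
  have hfpos : IsPosOp f.1 := isPosOp_sum_coe t hq
  let B : lrAlgebra X → (𝔛 →L[ℝ] ℝ) := fun T =>
    ∑ i ∈ s, ∑ j ∈ t, Λ (p i) (ρ (q j) (δ (p i * T * q j)))
  let b : ℕ → ℕ → (𝔛 →L[ℝ] ℝ) := fun i j => Λ (p i) (ρ (q j) (δ (E i j)))
  have hb : ∀ i j T, Λ (p i) (ρ (q j) (δ (p i * T * q j))) = τ i j T • b i j := by
    intro i j T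
    simp [hE, b]
  let ζ : 𝔛 →L[ℝ] ℝ := ∑ j ∈ t, ρ (q j) (δ (q j))
  let η : 𝔛 →L[ℝ] ℝ := ∑ i ∈ s, Λ (p i) (δ (p i))
  have hζ : ‖dualModulus ζ‖ ≤ K * C * (K * C) :=
    (norm_dualModulus_le ζ).trans (h.norm_sum_right_le t hq hCq)
  have hη : ‖dualModulus η‖ ≤ K * C * (K * C) :=
    (norm_dualModulus_le η).trans (h.norm_sum_left_le s hp hCp)
  have decomp : ∀ T, Λ e (ρ f (δ T)) = B T - Λ (e * T) ζ - ρ (T * f) η := by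
    intro T
    have term : ∀ i j, Λ (p i) (ρ (q j) (δ (p i * T * q j))) =
        Λ (p i * T) (ρ (q j) (δ (q j))) + Λ (p i) (ρ (q j) (δ T)) +
          ρ (T * q j) (Λ (p i) (δ (p i))) := by
      intro i j
      have i1 : Λ (p i) (ρ (q j) (Λ (p i * T) (δ (q j)))) = Λ (p i * T) (ρ (q j) (δ (q j))) := by
        rw [← h.comm, ← h.left_mul, ← mul_assoc, hpp, if_pos rfl]
      have i2 : Λ (p i) (ρ (q j) (ρ (q j) (Λ (p i) (δ T)))) = Λ (p i) (ρ (q j) (δ T)) := by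
        rw [← h.right_mul, hqq, if_pos rfl, ← h.comm, ← h.left_mul, hpp, if_pos rfl]
      have i3 : Λ (p i) (ρ (q j) (ρ (q j) (ρ T (δ (p i))))) =
          ρ (T * q j) (Λ (p i) (δ (p i))) := by
        rw [← h.right_mul, hqq, if_pos rfl, ← h.right_mul, h.comm]
      rw [h.leibniz (p i * T), h.leibniz (p i) T, map_add (ρ (q j)), map_add (ρ (q j)),
        map_add (ρ (q j)), map_add (Λ (p i)), map_add (Λ (p i)), i1, i2, i3, add_assoc]
    have hB : B T = Λ (e * T) ζ + Λ e (ρ f (δ T)) + ρ (T * f) η := by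
      simp only [B, term, Finset.sum_add_distrib]
      congr 1
      · congr 1
        · simp [e, ζ, Finset.sum_mul]
          exact Finset.sum_comm
        · simp [e, f]
          exact Finset.sum_comm
      · simp [f, η, Finset.mul_sum]
    rw [hB]
    abel
  have hband : ∀ i ∈ s, ∀ j ∈ t, ∀ T, Λ (p i) (ρ (q j) (B T)) = τ i j T • b i j := by
    intro i hi j hj T
    simp only [B, map_sum]
    rw [Finset.sum_eq_single_of_mem i hi, Finset.sum_eq_single_of_mem j hj]
    · rw [← h.comm, ← h.left_mul, hpp, if_pos rfl, ← h.right_mul, hqq, if_pos rfl, hb]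
    · intro l _ hl
      rw [← h.comm, ← h.left_mul, ← h.right_mul, hqq, if_neg hl]
      simp
    · intro k _ hk
      refine Finset.sum_eq_zero fun l _ => ?_
      rw [← h.comm, ← h.left_mul, hpp, if_neg (Ne.symm hk)]
      simp
  let P : lrAlgebra X →ₗ[ℝ] (𝔛 →L[ℝ] ℝ) :=
    ∑ i ∈ s, ∑ j ∈ t, (τ i j).smulRight (dualModulus (b i j)) +
      (Λ.flip (dualModulus ζ)).comp (LinearMap.mulLeft ℝ e) +
      (ρ.flip (dualModulus η)).comp (LinearMap.mulRight ℝ f)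
  have hP : ∀ T, P T = ∑ i ∈ s, ∑ j ∈ t, τ i j T • dualModulus (b i j) +
      Λ (e * T) (dualModulus ζ) + ρ (T * f) (dualModulus η) := by
    intro T
    simp [P]
  refine ⟨P, fun T hT => ?_⟩
  have heT : IsPosOp (e * T).1 := hepos.comp hT
  have hTf : IsPosOp (T * f).1 := hT.comp hfpos
  have n2 := h.left_pos _ heT _ (dualModulus_nonneg ζ)
  have n3 := h.right_pos _ hTf _ (dualModulus_nonneg η)
  have n1 : dualLe 0 (∑ i ∈ s, ∑ j ∈ t, τ i j T • dualModulus (b i j)) := by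
    intro y hy
    simp only [sum_apply, smul_apply, zero_apply, smul_eq_mul]
    exact Finset.sum_nonneg fun i _ => Finset.sum_nonneg fun j _ =>
      mul_nonneg (hτ i j T hT) (dualModulus_nonneg _ y hy)
  rw [hP]
  refine ⟨fun y hy => ?_, fun y hy => ?_, ?_⟩
  · have := add_nonneg (add_nonneg (n1 y hy) (n2 y hy)) (n3 y hy)
    exact this
  · change (Λ e (ρ f (δ T))) y ≤ _
    rw [decomp, sub_apply, sub_apply, add_apply, add_apply, sub_eq_add_neg, sub_eq_add_neg]
    refine add_le_add (add_le_add ?_ ?_) ?_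
    · simp only [B, hb, sum_apply, smul_apply, smul_eq_mul]
      exact Finset.sum_le_sum fun i _ => Finset.sum_le_sum fun j _ =>
        mul_le_mul_of_nonneg_left (le_dualModulus _ y hy) (hτ i j T hT)
    · have := dualLe.map (h.left_pos _ heT) (neg_le_dualModulus ζ) y hy
      rwa [map_neg] at this
    · have := dualLe.map (h.right_pos _ hTf) (neg_le_dualModulus η) y hy
      rwa [map_neg] at this
  · have b2 : ‖Λ (e * T) (dualModulus ζ)‖ ≤ K * C * (K * C * (K * C)) * ‖T.1‖ := by
      refine (h.norm_left_le heT.dominatedBy (C := C * ‖T.1‖) ?_ hζ).trans (le_of_eq (by ring))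
      exact (norm_mul_le _ _).trans (mul_le_mul_of_nonneg_right hCp (norm_nonneg _))
    have b3 : ‖ρ (T * f) (dualModulus η)‖ ≤ K * C * (K * C * (K * C)) * ‖T.1‖ := by
      refine (h.norm_right_le hTf.dominatedBy (C := ‖T.1‖ * C) ?_ hη).trans (le_of_eq (by ring))
      exact (norm_mul_le _ _).trans (mul_le_mul_of_nonneg_left hCq (norm_nonneg _))
    have dom : dualLe (∑ i ∈ s, ∑ j ∈ t, τ i j T • dualModulus (b i j))
        (Λ e (ρ f (dualModulus (B T)))) := by
      have e1 : Λ e (ρ f (dualModulus (B T))) =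
          ∑ i ∈ s, ∑ j ∈ t, Λ (p i) (ρ (q j) (dualModulus (B T))) := by
        simp [e, f]
        exact Finset.sum_comm
      rw [e1]
      intro y hy
      simp only [sum_apply]
      refine Finset.sum_le_sum fun i hi => Finset.sum_le_sum fun j hj => ?_
      have posmap : ∀ ξ, dualLe 0 ξ → dualLe 0 ((Λ (p i) ∘ₗ ρ (q j)) ξ) := fun ξ hξ =>
        h.left_pos _ (hp i) _ (h.right_pos _ (hq j) _ hξ)
      refine smul_dualModulus_le (hτ i j T hT) (posmap _ (dualModulus_nonneg _)) ?_ ?_ y hy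
      · rw [← hband i hi j hj]
        exact dualLe.map posmap (le_dualModulus _)
      · rw [← hband i hi j hj, ← map_neg, ← map_neg]
        exact dualLe.map posmap (neg_le_dualModulus _)
    have b1 : ‖∑ i ∈ s, ∑ j ∈ t, τ i j T • dualModulus (b i j)‖ ≤
        K * C * (K * C * (K * C * (K * C * (K * (C * C))))) * ‖T.1‖ := by
      refine (norm_le_of_dualLe n1 dom).trans ((h.norm_left_le hepos.dominatedBy hCp
        (h.norm_right_le hfpos.dominatedBy hCq ((norm_dualModulus_le _).trans
          (h.norm_sum_sum_le s t hp hq hCp hCq hT)))).trans (le_of_eq (by ring)))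
    calc _ ≤ _ := norm_add₃_le
      _ ≤ _ := add_le_add (add_le_add b1 b2) b3
      _ = _ := by ring

end IsBoundedDerivation

end Bimodule

section Limit

variable {X 𝔛 : Type*} [NormedAddCommGroup X] [Lattice X] [HasSolidNorm X] [IsOrderedAddMonoid X]
  [NormedSpace ℝ X] [NormedAddCommGroup 𝔛] [Lattice 𝔛] [HasSolidNorm 𝔛] [IsOrderedAddMonoid 𝔛]
  [NormedSpace ℝ 𝔛]

theorem tendsto_apply_of_tendsto_toWeakDual {ι : Type*} {F : Filter ι} {ξ : ι → 𝔛 →L[ℝ] ℝ}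
    {ψ : 𝔛 →L[ℝ] ℝ} (h : Tendsto (fun i => StrongDual.toWeakDual (ξ i)) F
      (𝓝 (StrongDual.toWeakDual ψ))) (y : 𝔛) : Tendsto (fun i => ξ i y) F (𝓝 (ψ y)) :=
  ((WeakDual.eval_continuous y).tendsto _).comp h

theorem exists_tendsto_of_norm_le {ι : Type*} (U : Ultrafilter ι) (ξ : ι → 𝔛 →L[ℝ] ℝ) {r : ℝ}
    (h : ∀ i, ‖ξ i‖ ≤ r) : ∃ ψ : 𝔛 →L[ℝ] ℝ, ∀ y, Tendsto (fun i => ξ i y) U (𝓝 (ψ y)) := by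
  obtain ⟨ψ, -, hψ⟩ := (WeakDual.isCompact_closedBall (𝕜 := ℝ) (E := 𝔛) 0 r).ultrafilter_le_nhds
    (U.map fun i => StrongDual.toWeakDual (ξ i)) (by
      rw [Ultrafilter.coe_map, le_principal_iff, mem_map]
      exact Eventually.of_forall (f := (U : Filter ι)) fun i => by simpa using h i)
  exact ⟨WeakDual.toStrongDual ψ, fun y => ((WeakDual.eval_continuous y).tendsto ψ).comp hψ⟩

theorem IsMajorized.of_tendsto {ι : Type*} {F : Filter ι} [F.NeBot] {C : ℝ}
    {R : ι → lrAlgebra X → (𝔛 →L[ℝ] ℝ)} {R' : lrAlgebra X → (𝔛 →L[ℝ] ℝ)}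
    (hR : ∀ i, IsMajorized C (R i))
    (hlim : ∀ T y, Tendsto (fun i => R i T y) F (𝓝 (R' T y))) : IsMajorized C R' := by
  choose P hP using hR
  let U := Ultrafilter.of F
  have hU : (U : Filter ι) ≤ F := Ultrafilter.of_le F
  have bdd : ∀ T, ∃ r, ∀ i, ‖P i T‖ ≤ r := fun T => by
    refine lrAlgebra_induction (p := fun T => ∃ r, ∀ i, ‖P i T‖ ≤ r) (fun T hT => ⟨_, fun i => (hP i T hT).2.2⟩) ?_ ?_ T
    · rintro S T ⟨r, hr⟩ ⟨s, hs⟩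
      refine ⟨r + s, fun i => ?_⟩
      rw [map_add]
      exact norm_add_le_of_le (hr i) (hs i)
    · rintro c T ⟨r, hr⟩
      refine ⟨‖c‖ * r, fun i => ?_⟩
      rw [map_smul, norm_smul]
      exact mul_le_mul_of_nonneg_left (hr i) (norm_nonneg c)
  have lim : ∀ T, ∃ ψ : 𝔛 →L[ℝ] ℝ, ∀ y, Tendsto (fun i => P i T y) U (𝓝 (ψ y)) := fun T =>
    exists_tendsto_of_norm_le U _ (bdd T).choose_spec
  choose G hG using lim
  refine ⟨⟨⟨G, fun S T => ?_⟩, fun c T => ?_⟩, fun T hT => ⟨fun y hy => ?_, fun y hy => ?_, ?_⟩⟩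
  · ext y
    refine tendsto_nhds_unique (hG (S + T) y) ?_
    simpa using (hG S y).add (hG T y)
  · ext y
    refine tendsto_nhds_unique (hG (c • T) y) ?_
    simpa using (hG T y).const_mul c
  · exact ge_of_tendsto (hG T y) (Eventually.of_forall fun i => (hP i T hT).1 y hy)
  · exact le_of_tendsto_of_tendsto ((hlim T y).mono_left hU) (hG T y)
      (Eventually.of_forall fun i => (hP i T hT).2.1 y hy)
  · rcases isEmpty_or_nonempty ι with hι | ⟨⟨i₀⟩⟩
    · exact absurd (Subsingleton.elim F ⊥) (NeBot.ne ‹_›)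
    · refine (G T).opNorm_le_bound ((norm_nonneg _).trans (hP i₀ T hT).2.2) fun y => ?_
      exact le_of_tendsto (hG T y).norm (Eventually.of_forall fun i =>
        (P i T).le_of_opNorm_le (hP i T hT).2.2 y)

theorem piFilter_neBot {Pi : Set (X →L[ℝ] X)} (hne : Pi.Nonempty)
    (hdir : ∀ σ₁ ∈ Pi, ∀ σ₂ ∈ Pi, ∃ σ₃ ∈ Pi,
      Set.range ⇑σ₁ ⊆ Set.range ⇑σ₃ ∧ Set.range ⇑σ₂ ⊆ Set.range ⇑σ₃) : (piFilter Pi).NeBot := by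
  have : Nonempty {σ : X →L[ℝ] X // σ ∈ Pi} := hne.to_subtype
  refine iInf_neBot_of_directed' ?_ fun σ => principal_neBot_iff.2 ⟨σ, Set.Subset.rfl (s := Set.range ⇑σ.1)⟩
  rintro ⟨σ₁, h₁⟩ ⟨σ₂, h₂⟩
  obtain ⟨σ₃, h₃, h13, h23⟩ := hdir σ₁ h₁ σ₂ h₂
  exact ⟨⟨σ₃, h₃⟩, principal_mono.2 fun _ h => h13.trans h, principal_mono.2 fun _ h => h23.trans h⟩

end Limit

section AtomicBasis

variable {X : Type*} [NormedAddCommGroup X] [Lattice X] [HasSolidNorm X] [IsOrderedAddMonoid X]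
  [NormedSpace ℝ X] {σ : X →L[ℝ] X} {x : ℕ → X} {xs : ℕ → X →L[ℝ] ℝ}

theorem eproj_apply (x : ℕ → X) (xs : ℕ → X →L[ℝ] ℝ) (n : ℕ) (y : X) :
    eproj x xs n y = ∑ i ∈ Finset.range n, xs i y • x i := by
  simp [eproj]

theorem inf_eq_zero_of_isNormAtomOn
    (hsup : ∀ y ∈ Set.range ⇑σ, ∀ z ∈ Set.range ⇑σ, y ⊔ z ∈ Set.range ⇑σ)
    (hx : ∀ i, IsNormAtomOn (Set.range ⇑σ) (x i))
    (hbi : ∀ i j, xs i (x j) = if i = j then (1 : ℝ) else 0) {i j : ℕ} (hij : i ≠ j) :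
    x i ⊓ x j = 0 := by
  have hmem : x i ⊓ x j ∈ Set.range ⇑σ := by
    have : x i ⊓ x j = x i + x j - x i ⊔ x j := by
      rw [← inf_add_sup (x i) (x j), add_sub_cancel_right]
    rw [this]
    obtain ⟨u, hu⟩ := (hx i).1
    obtain ⟨v, hv⟩ := (hx j).1
    obtain ⟨w, hw⟩ := hsup _ (hx i).1 _ (hx j).1
    exact ⟨u + v - w, by rw [map_sub, map_add, hu, hv, hw]⟩
  have h0 : 0 ≤ x i ⊓ x j := le_inf (hx i).2.1.le (hx j).2.1.le
  obtain ⟨c, hc⟩ := (hx i).2.2.2 _ hmem h0 inf_le_left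
  obtain ⟨d, hd⟩ := (hx j).2.2.2 _ hmem h0 inf_le_right
  have : c = 0 := by
    have := congrArg (xs i) (hc.symm.trans hd)
    simpa [hbi, hij] using this
  rw [hc, this, zero_smul]

theorem abs_eproj_apply (hx : ∀ i, 0 ≤ x i) (hd : ∀ i j, i ≠ j → x i ⊓ x j = 0) (n : ℕ) (y : X) :
    |eproj x xs n y| = ∑ i ∈ Finset.range n, |xs i y| • x i := by
  rw [eproj_apply, abs_sum_smul_of_disjoint _ x hx hd]

theorem coordinate_nonneg (hσ : IsPosOp σ) (hx : ∀ i, 0 ≤ x i)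
    (hd : ∀ i j, i ≠ j → x i ⊓ x j = 0) (hfac : ∀ i, (xs i).comp σ = xs i)
    (hbi : ∀ i j, xs i (x j) = if i = j then (1 : ℝ) else 0)
    (hbasis : ∀ y ∈ Set.range ⇑σ, Tendsto (fun n => eproj x xs n y) atTop (𝓝 y))
    (i : ℕ) {y : X} (hy : 0 ≤ y) : 0 ≤ xs i y := by
  have hfac' : xs i (σ y) = xs i y := DFunLike.congr_fun (hfac i) y
  have lim := ((xs i).continuous.tendsto _).comp
    (((continuous_id.sup continuous_neg).tendsto _).comp (hbasis (σ y) ⟨y, rfl⟩))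
  change Tendsto (fun n => xs i |eproj x xs n (σ y)|) atTop (𝓝 (xs i |σ y|)) at lim
  rw [abs_of_nonneg (hσ y hy), hfac'] at lim
  refine ge_of_tendsto lim (Eventually.of_forall fun n => ?_)
  simp only [abs_eproj_apply hx hd, map_sum, map_smul, hbi, smul_eq_mul]
  exact Finset.sum_nonneg fun j _ => mul_nonneg (abs_nonneg _) (by split_ifs <;> norm_num)

theorem isPosOp_smulRight {l : X →L[ℝ] ℝ} (hl : ∀ y, 0 ≤ y → 0 ≤ l y) {a : X} (ha : 0 ≤ a) :
    IsPosOp (l.smulRight a) := fun y hy => by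
  rw [ContinuousLinearMap.smulRight_apply]
  exact smul_nonneg_of_hasSolidNorm (hl y hy) ha

theorem norm_eproj_le (hx : ∀ i, 0 ≤ x i)
    (hxs : ∀ i y, 0 ≤ y → 0 ≤ xs i y) (hfac : ∀ i, (xs i).comp σ = xs i)
    (hbasis : ∀ y ∈ Set.range ⇑σ, Tendsto (fun n => eproj x xs n y) atTop (𝓝 y)) (n : ℕ) :
    ‖eproj x xs n‖ ≤ ‖σ‖ := by
  have hpos : IsPosOp (eproj x xs n) := IsPosOp.sum _ fun i => isPosOp_smulRight (hxs i) (hx i)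
  have key : ∀ y, 0 ≤ y → eproj x xs n y ≤ σ y := fun y hy => by
    have hfac' : ∀ i, xs i (σ y) = xs i y := fun i => DFunLike.congr_fun (hfac i) y
    refine ge_of_tendsto (hbasis (σ y) ⟨y, rfl⟩) ((eventually_ge_atTop n).mono fun m hm => ?_)
    simp only [eproj_apply, hfac']
    exact Finset.sum_le_sum_of_subset_of_nonneg (Finset.range_mono hm) fun i _ _ =>
      smul_nonneg_of_hasSolidNorm (hxs i y hy) (hx i)
  exact DominatedBy.norm_le fun y => (hpos.dominatedBy y).trans (key _ (abs_nonneg y))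

end AtomicBasis
section Compression

variable {X 𝔛 : Type*} [NormedAddCommGroup X] [Lattice X] [HasSolidNorm X] [IsOrderedAddMonoid X]
  [NormedSpace ℝ X] [NormedAddCommGroup 𝔛] [Lattice 𝔛] [HasSolidNorm 𝔛] [IsOrderedAddMonoid 𝔛]
  [NormedSpace ℝ 𝔛]

/-- A biorthogonal system of positive vectors and positive functionals whose partial sum
projections are bounded by `C`. -/
structure IsPositiveSystem (C : ℝ) (x : ℕ → X) (xs : ℕ → X →L[ℝ] ℝ) : Prop where
  nonneg : ∀ i, 0 ≤ x i
  coord_nonneg : ∀ i y, 0 ≤ y → 0 ≤ xs i y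
  biorthogonal : ∀ i j, xs i (x j) = if i = j then (1 : ℝ) else 0
  norm_le : ∀ n, ‖eproj x xs n‖ ≤ C

namespace IsPositiveSystem

variable {C : ℝ} {x y : ℕ → X} {xs ys : ℕ → X →L[ℝ] ℝ}

theorem isPosOp_eproj (hx : IsPositiveSystem C x xs) (n : ℕ) : IsPosOp (eproj x xs n) :=
  IsPosOp.sum _ fun i => isPosOp_smulRight (hx.coord_nonneg i) (hx.nonneg i)

/-- The partial sum projection as a regular operator. -/
noncomputable def proj (hx : IsPositiveSystem C x xs) (n : ℕ) : lrAlgebra X :=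
  ⟨eproj x xs n, (hx.isPosOp_eproj n).mem_LrSet⟩

theorem isMajorized_proj (hx : IsPositiveSystem C x xs) (hy : IsPositiveSystem C y ys)
    {Λ ρ : lrAlgebra X →ₗ[ℝ] (𝔛 →L[ℝ] ℝ) →ₗ[ℝ] (𝔛 →L[ℝ] ℝ)}
    {δ : lrAlgebra X →ₗ[ℝ] (𝔛 →L[ℝ] ℝ)} {K : ℝ} (h : IsBoundedDerivation Λ ρ δ K) (m n : ℕ) :
    IsMajorized (K * C * (K * C * (K * C * (K * C * (K * (C * C))))) +
        K * C * (K * C * (K * C)) + K * C * (K * C * (K * C)))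
      (fun T => Λ (hx.proj m) (ρ (hy.proj n) (δ T))) := by
  have pos {u v : ℕ → X} {us vs : ℕ → X →L[ℝ] ℝ} (hu : IsPositiveSystem C u us)
      (hv : IsPositiveSystem C v vs) (i j : ℕ) : IsPosOp ((vs j).smulRight (u i)) :=
    isPosOp_smulRight (hv.coord_nonneg j) (hu.nonneg i)
  have coe {u : ℕ → X} {us : ℕ → X →L[ℝ] ℝ} (hu : IsPositiveSystem C u us) (n : ℕ) :
      hu.proj n = ∑ i ∈ Finset.range n,
        (⟨(us i).smulRight (u i), (pos hu hu i i).mem_LrSet⟩ : lrAlgebra X) := by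
    ext1
    simp [proj, eproj]
  have mul {u : ℕ → X} {us : ℕ → X →L[ℝ] ℝ} (hu : IsPositiveSystem C u us) (i j : ℕ) :
      (⟨(us i).smulRight (u i), (pos hu hu i i).mem_LrSet⟩ : lrAlgebra X) *
        ⟨(us j).smulRight (u j), (pos hu hu j j).mem_LrSet⟩ =
      if i = j then ⟨(us i).smulRight (u i), (pos hu hu i i).mem_LrSet⟩ else 0 := by
    ext1
    ext z
    split_ifs with hij
    · subst hij
      simp [hu.biorthogonal]
    · simp [hu.biorthogonal, hij]
  have hCx := hx.norm_le m
  have hCy := hy.norm_le n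
  change ‖(hx.proj m).1‖ ≤ C at hCx
  change ‖(hy.proj n).1‖ ≤ C at hCy
  rw [coe hx] at hCx ⊢
  rw [coe hy] at hCy ⊢
  refine h.isMajorized_compress (Finset.range m) (Finset.range n)
    (E := fun i j => ⟨(ys j).smulRight (x i), (pos hx hy i j).mem_LrSet⟩)
    (τ := fun i j => ((xs i : X →ₗ[ℝ] ℝ).comp (LinearMap.applyₗ (y j))).comp
      ((ContinuousLinearMap.coeLM ℝ).comp (lrAlgebra X).val.toLinearMap))
    (fun i => pos hx hx i i) (fun i => pos hy hy i i) (mul hx) (mul hy) ?_ ?_ hCx hCy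
  · intro i j T
    ext1
    ext z
    simp [smul_smul, mul_comm]
  · intro i j T hT
    exact hx.coord_nonneg _ _ (hT _ (hy.nonneg j))

end IsPositiveSystem

theorem IsBoundedDerivation.exists_positive_decomposition
    {Λ ρ : lrAlgebra X →ₗ[ℝ] (𝔛 →L[ℝ] ℝ) →ₗ[ℝ] (𝔛 →L[ℝ] ℝ)}
    {δ : lrAlgebra X →ₗ[ℝ] (𝔛 →L[ℝ] ℝ)} {K : ℝ} (h : IsBoundedDerivation Λ ρ δ K) {C : ℝ}
    (hmaj : IsMajorized C fun T => Λ 1 (ρ 1 (δ T))) :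
    ∃ P : lrAlgebra X →ₗ[ℝ] (𝔛 →L[ℝ] ℝ), ∀ T, IsPosOp T.1 →
      dualLe 0 (P T) ∧ dualLe (δ T) (P T) := by
  obtain ⟨P, hP⟩ := hmaj
  refine ⟨P + Λ.flip (dualModulus (δ 1)) + ρ.flip (dualModulus (δ 1)), fun T hT => ?_⟩
  obtain ⟨h₀, h₁, -⟩ := hP T hT
  have l₀ := h.left_pos T hT _ (dualModulus_nonneg (δ 1))
  have r₀ := h.right_pos T hT _ (dualModulus_nonneg (δ 1))
  have l₁ := dualLe.map (h.left_pos T hT) (le_dualModulus (δ 1))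
  have r₁ := dualLe.map (h.right_pos T hT) (le_dualModulus (δ 1))
  have decomp : δ T = Λ 1 (ρ 1 (δ T)) + Λ T (δ 1) + ρ T (δ 1) := by
    have e₁ := h.leibniz 1 T
    have e₂ := h.leibniz T 1
    rw [one_mul] at e₁
    rw [mul_one] at e₂
    have e₃ : ρ 1 (δ T) = Λ 1 (ρ 1 (δ T)) + ρ T (δ 1) := by
      conv_lhs => rw [e₁]
      rw [map_add, ← h.comm, ← h.right_mul, mul_one]
    conv_lhs => rw [e₂, e₃]
    abel
  refine ⟨fun y hy => ?_, fun y hy => ?_⟩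
  · exact add_nonneg (add_nonneg (h₀ y hy) (l₀ y hy)) (r₀ y hy)
  · rw [decomp]
    exact add_le_add (add_le_add (h₁ y hy) (l₁ y hy)) (r₁ y hy)

end Compression
theorem nonatomic_Lr_derivation_regular
    {X 𝔛 : Type*} [NormedAddCommGroup X] [Lattice X] [HasSolidNorm X] [IsOrderedAddMonoid X] [NormedSpace ℝ X] [CompleteSpace X]
    [NormedAddCommGroup 𝔛] [Lattice 𝔛] [HasSolidNorm 𝔛] [IsOrderedAddMonoid 𝔛] [NormedSpace ℝ 𝔛] [CompleteSpace 𝔛]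
    (μ : ℝ) (hμ : 1 ≤ μ)
    -- Π is a directed bounded generating system for X:
    (Pgen : Set (X →L[ℝ] X))
    (hPgpos : ∀ σ ∈ Pgen, IsPosOp σ)
    (hPgproj : ∀ σ ∈ Pgen, σ ∘L σ = σ)
    (hPgbdd : ∃ C : ℝ, ∀ σ ∈ Pgen, ‖σ‖ ≤ C)
    (hPgriesz : ∀ σ ∈ Pgen, ∀ y ∈ Set.range ⇑σ, ∀ z ∈ Set.range ⇑σ, y ⊔ z ∈ Set.range ⇑σ)
    (hPgdense : ∀ (ξ : X) (ε : ℝ), 0 < ε → ∃ σ ∈ Pgen, ∃ y ∈ Set.range ⇑σ, ‖ξ - y‖ < ε)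
    (hPgdir : ∀ σ₁ ∈ Pgen, ∀ σ₂ ∈ Pgen, ∃ σ₃ ∈ Pgen,
      Set.range ⇑σ₁ ⊆ Set.range ⇑σ₃ ∧ Set.range ⇑σ₂ ⊆ Set.range ⇑σ₃)
    -- for each σ ∈ Π, (xb σ i) is a shrinking basis for σ(X) satisfying (⋆) with
    -- constant μ in each summand, with biorthogonal functionals (xsb σ i); the
    -- natural projections ι_σ e_n^{(σ)} p_σ ∈ ℒʳ(X) are eproj (xb σ) (xsb σ) n:
    (xb : (X →L[ℝ] X) → ℕ → X) (xsb : (X →L[ℝ] X) → ℕ → (X →L[ℝ] ℝ))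
    (hxbmem : ∀ σ ∈ Pgen, ∀ i, xb σ i ∈ Set.range ⇑σ)
    (hxsbfac : ∀ σ ∈ Pgen, ∀ i, (xsb σ i).comp σ = xsb σ i)
    (hstarσ : ∀ σ ∈ Pgen, StarSummandBasisOn (Set.range ⇑σ) μ (xb σ))
    (hbiσ : ∀ σ ∈ Pgen, ∀ i j, xsb σ i (xb σ j) = if i = j then (1 : ℝ) else 0)
    (hbasisσ : ∀ σ ∈ Pgen, ∀ y ∈ Set.range ⇑σ,
      Tendsto (fun n => eproj (xb σ) (xsb σ) n y) atTop (𝓝 y))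
    (hshrinkσ : ∀ σ ∈ Pgen, ∀ l : X →L[ℝ] ℝ,
      Tendsto (fun n => sSup {r : ℝ | ∃ y ∈ Set.range ⇑σ, ‖y‖ ≤ 1 ∧
        r = |l y - l (eproj (xb σ) (xsb σ) n y)|}) atTop (𝓝 0))
    -- lim_σ ‖λ − λ∘σ‖ = 0 for every λ ∈ X′:
    (hdualconv : ∀ l : X →L[ℝ] ℝ,
      Tendsto (fun σ : {σ : X →L[ℝ] X // σ ∈ Pgen} => ‖l - l.comp σ.val‖)
        (piFilter Pgen) (𝓝 0))
    -- 𝔛 is a Banach lattice ℒʳ(X)-module, with actions Ml, Mr and constant M: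
    (Ml Mr : (X →L[ℝ] X) → 𝔛 → 𝔛) (M : ℝ)
    (hMladd : ∀ a ∈ LrSet X, ∀ y₁ y₂ : 𝔛, Ml a (y₁ + y₂) = Ml a y₁ + Ml a y₂)
    (hMradd : ∀ a ∈ LrSet X, ∀ y₁ y₂ : 𝔛, Mr a (y₁ + y₂) = Mr a y₁ + Mr a y₂)
    (hMllin : ∀ a ∈ LrSet X, ∀ b ∈ LrSet X, ∀ (s t : ℝ) (y : 𝔛),
      Ml (s • a + t • b) y = s • Ml a y + t • Ml b y)
    (hMrlin : ∀ a ∈ LrSet X, ∀ b ∈ LrSet X, ∀ (s t : ℝ) (y : 𝔛),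
      Mr (s • a + t • b) y = s • Mr a y + t • Mr b y)
    (hMlmul : ∀ a ∈ LrSet X, ∀ b ∈ LrSet X, ∀ y : 𝔛, Ml (a ∘L b) y = Ml a (Ml b y))
    (hMrmul : ∀ a ∈ LrSet X, ∀ b ∈ LrSet X, ∀ y : 𝔛, Mr (a ∘L b) y = Mr b (Mr a y))
    (hMlr : ∀ a ∈ LrSet X, ∀ b ∈ LrSet X, ∀ y : 𝔛, Ml a (Mr b y) = Mr b (Ml a y))
    (hMpos : ∀ a ∈ LrSet X, IsPosOp a → ∀ y : 𝔛, 0 ≤ y → 0 ≤ Ml a y ∧ 0 ≤ Mr a y)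
    (hMbd : ∀ a ∈ LrSet X, ∀ y : 𝔛,
      ‖Ml a y‖ ≤ M * rnorm a * ‖y‖ ∧ ‖Mr a y‖ ≤ M * rnorm a * ‖y‖)
    -- dual module products on 𝔛′ := 𝔛 →L[ℝ] ℝ :
    (DL DR : (X →L[ℝ] X) → (𝔛 →L[ℝ] ℝ) → (𝔛 →L[ℝ] ℝ))
    (hDL : ∀ a ∈ LrSet X, ∀ (x' : 𝔛 →L[ℝ] ℝ) (y : 𝔛), DL a x' y = x' (Mr a y))
    (hDR : ∀ a ∈ LrSet X, ∀ (x' : 𝔛 →L[ℝ] ℝ) (y : 𝔛), DR a x' y = x' (Ml a y))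
    -- weak*-lim_σ σ·x′ = e·x′ and weak*-lim_σ x′·σ = x′·e (e = id_X):
    (hwlimσ : ∀ x' : 𝔛 →L[ℝ] ℝ,
      Tendsto (fun σ : {σ : X →L[ℝ] X // σ ∈ Pgen} =>
          StrongDual.toWeakDual (DL σ.val x')) (piFilter Pgen)
        (𝓝 (StrongDual.toWeakDual (DL (ContinuousLinearMap.id ℝ X) x'))) ∧
      Tendsto (fun σ : {σ : X →L[ℝ] X // σ ∈ Pgen} =>
          StrongDual.toWeakDual (DR σ.val x')) (piFilter Pgen)
        (𝓝 (StrongDual.toWeakDual (DR (ContinuousLinearMap.id ℝ X) x'))))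
    -- weak*-lim_n e_n^{(σ)}·x′ = σ·x′ and weak*-lim_n x′·e_n^{(σ)} = x′·σ :
    (hwlimn : ∀ σ ∈ Pgen, ∀ x' : 𝔛 →L[ℝ] ℝ,
      Tendsto (fun n => StrongDual.toWeakDual (DL (eproj (xb σ) (xsb σ) n) x'))
        atTop (𝓝 (StrongDual.toWeakDual (DL σ x'))) ∧
      Tendsto (fun n => StrongDual.toWeakDual (DR (eproj (xb σ) (xsb σ) n) x'))
        atTop (𝓝 (StrongDual.toWeakDual (DR σ x'))))
    -- (i), (ii) or (iii):
    (hcases :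
      -- (i): X contains no copy of ℓ₁ and 𝔛 contains no complemented copy of ℓ₁:
      (¬ HasL1Copy X ∧ ¬ HasComplementedL1 𝔛) ∨
      -- (ii): X is reflexive and dim(e_n^{(σ)}·𝔛′·e_n^{(σ)}) < ∞ :
      (Function.Surjective (NormedSpace.inclusionInDoubleDual ℝ X) ∧
        ∀ σ ∈ Pgen, ∀ n : ℕ, ∃ (m : ℕ) (b : Fin m → (𝔛 →L[ℝ] ℝ)),
          ∀ ξ : 𝔛 →L[ℝ] ℝ,
            (∃ x' : 𝔛 →L[ℝ] ℝ,
              ξ = DL (eproj (xb σ) (xsb σ) n) (DR (eproj (xb σ) (xsb σ) n) x')) →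
            ∃ c : Fin m → ℝ, ξ = ∑ t, c t • b t) ∨
      -- (iii): X contains no copy of ℓ₁ and every bounded derivation from 𝒜ʳ(X) to
      --        𝔛′ is inner:
      (¬ HasL1Copy X ∧
        ∀ D₀ : (X →L[ℝ] X) → (𝔛 →L[ℝ] ℝ),
          (∀ a ∈ ArSet X, ∀ b ∈ ArSet X, D₀ (a + b) = D₀ a + D₀ b) →
          (∀ (r : ℝ), ∀ a ∈ ArSet X, D₀ (r • a) = r • D₀ a) →
          (∀ a ∈ ArSet X, ∀ b ∈ ArSet X, D₀ (a ∘L b) = DL a (D₀ b) + DR b (D₀ a)) →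
          (∃ C : ℝ, ∀ a ∈ ArSet X, ‖D₀ a‖ ≤ C * rnorm a) →
          ∃ ξ : 𝔛 →L[ℝ] ℝ, ∀ a ∈ ArSet X, D₀ a = DL a ξ - DR a ξ))
    -- D is a bounded derivation from ℒʳ(X) to 𝔛′:
    (D : (X →L[ℝ] X) → (𝔛 →L[ℝ] ℝ))
    (hDadd : ∀ a ∈ LrSet X, ∀ b ∈ LrSet X, D (a + b) = D a + D b)
    (hDsmul : ∀ (r : ℝ), ∀ a ∈ LrSet X, D (r • a) = r • D a)
    (hDder : ∀ a ∈ LrSet X, ∀ b ∈ LrSet X, D (a ∘L b) = DL a (D b) + DR b (D a))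
    (hDbdd : ∃ C : ℝ, ∀ a ∈ LrSet X, ‖D a‖ ≤ C * rnorm a) :
    RegularDerivOn (LrSet X) D := by
  obtain ⟨C, hC⟩ := hPgbdd
  obtain ⟨B, hB⟩ := hDbdd
  have hsys : ∀ σ ∈ Pgen, IsPositiveSystem C (xb σ) (xsb σ) := fun σ hσ => by
    obtain ⟨-, -, -, -, -, hatom, -⟩ := hstarσ σ hσ
    have hnn : ∀ i, 0 ≤ xb σ i := fun i => (hatom i).2.1.le
    have hcoord : ∀ i y, 0 ≤ y → 0 ≤ xsb σ i y := fun i y hy =>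
      coordinate_nonneg (hPgpos σ hσ) hnn
        (fun i j => inf_eq_zero_of_isNormAtomOn (hPgriesz σ hσ) hatom (hbiσ σ hσ))
        (hxsbfac σ hσ) (hbiσ σ hσ) (hbasisσ σ hσ) i hy
    exact ⟨hnn, hcoord, hbiσ σ hσ, fun n =>
      (norm_eproj_le hnn hcoord (hxsbfac σ hσ) (hbasisσ σ hσ) n).trans (hC σ hσ)⟩
  let Λ : lrAlgebra X →ₗ[ℝ] (𝔛 →L[ℝ] ℝ) →ₗ[ℝ] (𝔛 →L[ℝ] ℝ) :=
    LinearMap.mk₂ ℝ (fun a => DL a.1)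
      (fun a b ξ => by
        ext y
        have := hMrlin _ a.2 _ b.2 1 1 y
        simp only [one_smul] at this
        rw [add_apply, hDL _ a.2, hDL _ b.2, hDL _ (a + b).2, ← map_add, ← this]
        rfl)
      (fun c a ξ => by
        ext y
        have := hMrlin _ a.2 _ a.2 c 0 y
        simp only [zero_smul, add_zero] at this
        rw [smul_apply, hDL _ a.2, hDL _ (c • a).2, ← map_smul, ← this]
        rfl)
      (fun a ξ ψ => by ext y; simp [hDL _ a.2])
      (fun c a ξ => by ext y; simp [hDL _ a.2])
  let ρ : lrAlgebra X →ₗ[ℝ] (𝔛 →L[ℝ] ℝ) →ₗ[ℝ] (𝔛 →L[ℝ] ℝ) :=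
    LinearMap.mk₂ ℝ (fun a => DR a.1)
      (fun a b ξ => by
        ext y
        have := hMllin _ a.2 _ b.2 1 1 y
        simp only [one_smul] at this
        rw [add_apply, hDR _ a.2, hDR _ b.2, hDR _ (a + b).2, ← map_add, ← this]
        rfl)
      (fun c a ξ => by
        ext y
        have := hMllin _ a.2 _ a.2 c 0 y
        simp only [zero_smul, add_zero] at this
        rw [smul_apply, hDR _ a.2, hDR _ (c • a).2, ← map_smul, ← this]
        rfl)
      (fun a ξ ψ => by ext y; simp [hDR _ a.2])
      (fun c a ξ => by ext y; simp [hDR _ a.2])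
  let δ : lrAlgebra X →ₗ[ℝ] (𝔛 →L[ℝ] ℝ) :=
    { toFun := fun a => D a.1
      map_add' := fun a b => hDadd _ a.2 _ b.2
      map_smul' := fun c a => hDsmul c _ a.2 }
  have hΛ : ∀ a ξ y, Λ a ξ y = ξ (Mr a.1 y) := fun a ξ y => hDL _ a.2 ξ y
  have hρ : ∀ a ξ y, ρ a ξ y = ξ (Ml a.1 y) := fun a ξ y => hDR _ a.2 ξ y
  have hact : ∀ {T S : X →L[ℝ] X}, DominatedBy T S → ∀ (N : 𝔛 → 𝔛) (ξ ψ : 𝔛 →L[ℝ] ℝ),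
      (∀ y, ψ y = ξ (N y)) → (∀ y, ‖N y‖ ≤ M * rnorm T * ‖y‖) →
      ‖ψ‖ ≤ max |M| |B| * ‖S‖ * ‖ξ‖ := fun {T S} h N ξ ψ hψ hN => by
    have hM : M * rnorm T ≤ max |M| |B| * ‖S‖ :=
      mul_le_mul ((le_abs_self M).trans (le_max_left _ _)) h.rnorm_le (rnorm_nonneg T)
        ((abs_nonneg M).trans (le_max_left _ _))
    refine ψ.opNorm_le_bound (by positivity) fun y => ?_
    rw [hψ]
    refine (ξ.le_opNorm_of_le ((hN y).trans
      (mul_le_mul_of_nonneg_right hM (norm_nonneg y)))).trans (le_of_eq (by ring))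
  have hder : IsBoundedDerivation Λ ρ δ (max |M| |B|) :=
    { nonneg := (abs_nonneg M).trans (le_max_left _ _)
      left_mul := fun a b ξ => by
        ext y
        rw [hΛ, hΛ, hΛ, ← hMrmul _ a.2 _ b.2]
        rfl
      right_mul := fun a b ξ => by
        ext y
        rw [hρ, hρ, hρ, ← hMlmul _ a.2 _ b.2]
        rfl
      comm := fun a b ξ => by
        ext y
        rw [hΛ, hρ, hρ, hΛ, hMlr _ b.2 _ a.2]
      left_pos := fun a ha ξ hξ y hy => by
        rw [hΛ]
        exact hξ _ (hMpos _ a.2 ha y hy).2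
      right_pos := fun a ha ξ hξ y hy => by
        rw [hρ]
        exact hξ _ (hMpos _ a.2 ha y hy).1
      left_bound := fun a S h ξ => hact h _ ξ _ (hΛ a ξ) fun y => (hMbd _ a.2 y).2
      right_bound := fun a S h ξ => hact h _ ξ _ (hρ a ξ) fun y => (hMbd _ a.2 y).1
      leibniz := fun a b => hDder _ a.2 _ b.2
      bound := fun a S h => (hB _ a.2).trans (mul_le_mul
        ((le_abs_self B).trans (le_max_right _ _)) h.rnorm_le (rnorm_nonneg _)
        ((abs_nonneg M).trans (le_max_left _ _))) }
  obtain ⟨σ₀, hσ₀, -⟩ := hPgdense 0 1 one_pos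
  have := piFilter_neBot ⟨σ₀, hσ₀⟩ hPgdir
  let κ : {σ : X →L[ℝ] X // σ ∈ Pgen} → lrAlgebra X := fun σ =>
    ⟨σ.1, (hPgpos _ σ.2).mem_LrSet⟩
  obtain ⟨P, hP⟩ := hder.exists_positive_decomposition <|
    IsMajorized.of_tendsto (F := piFilter Pgen)
      (R := fun σ T => Λ (κ σ) (ρ 1 (δ T)))
      (fun σ => IsMajorized.of_tendsto (F := atTop)
        (R := fun m T => Λ ((hsys _ σ.2).proj m) (ρ 1 (δ T)))
        (fun m => IsMajorized.of_tendsto (F := piFilter Pgen)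
          (R := fun τ T => Λ ((hsys _ σ.2).proj m) (ρ (κ τ) (δ T)))
          (fun τ => IsMajorized.of_tendsto (F := atTop)
            (fun n => (hsys _ σ.2).isMajorized_proj (hsys _ τ.2) hder m n)
            fun T y => by
              simp only [hΛ]
              exact tendsto_apply_of_tendsto_toWeakDual (hwlimn _ τ.2 (δ T)).2 _)
          fun T y => by
            simp only [hΛ]
            exact tendsto_apply_of_tendsto_toWeakDual (hwlimσ (δ T)).2 _)
        fun T y => tendsto_apply_of_tendsto_toWeakDual (hwlimn _ σ.2 (ρ 1 (δ T))).1 y)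
      fun T y => tendsto_apply_of_tendsto_toWeakDual (hwlimσ (ρ 1 (δ T))).1 y
  classical
  have hQ : ∀ Q : lrAlgebra X →ₗ[ℝ] (𝔛 →L[ℝ] ℝ), (∀ T, IsPosOp T.1 → dualLe 0 (Q T)) →
      (fun Q' : (X →L[ℝ] X) → (𝔛 →L[ℝ] ℝ) =>
        (∀ a ∈ LrSet X, ∀ b ∈ LrSet X, Q' (a + b) = Q' a + Q' b) ∧
        (∀ (r : ℝ), ∀ a ∈ LrSet X, Q' (r • a) = r • Q' a) ∧
        (∀ a ∈ LrSet X, IsPosOp a → dualLe 0 (Q' a)))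
      (fun a => if h : a ∈ LrSet X then Q ⟨a, h⟩ else 0) := fun Q hQ => by
    refine ⟨fun a ha b hb => ?_, fun r a ha => ?_, fun a ha hpos => ?_⟩
    · have hab : a + b ∈ LrSet X := (lrAlgebra X).add_mem ha hb
      simp only [dif_pos ha, dif_pos hb, dif_pos hab, ← map_add]
      rfl
    · have hra : r • a ∈ LrSet X := (lrAlgebra X).smul_mem ha r
      simp only [dif_pos ha, dif_pos hra, ← map_smul]
      rfl
    · simp only [dif_pos ha]
      exact hQ _ hpos
  refine ⟨2, ![1, -1], ![fun a => if h : a ∈ LrSet X then P ⟨a, h⟩ else 0,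
    fun a => if h : a ∈ LrSet X then (P - δ) ⟨a, h⟩ else 0], ?_, fun a ha => ?_⟩
  · rw [Fin.forall_fin_two]
    refine ⟨hQ P fun T hT => (hP T hT).1, hQ (P - δ) fun T hT y hy => ?_⟩
    have := (hP T hT).2 y hy
    simpa using this
  · have : D a = (1 : ℝ) • P ⟨a, ha⟩ + (-1 : ℝ) • (P ⟨a, ha⟩ - D a) := by
      ext y
      change D a y = 1 * P ⟨a, ha⟩ y + -1 * (P ⟨a, ha⟩ y - D a y)
      ring
    simpa [Fin.sum_univ_two, ha, δ] using this
end

section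
/- Let (𝒜, τ) be a topological algebra and let (x_n) be a sequence in 𝒜 such that the sequence (x_n z_n) converges whenever (z_n) is a convergent sequence in 𝒜. If (z_n) is a sequence in 𝒜 converging to 0, then (x_n z_n) converges to 0. Similarly, if (y_n) is a sequence in 𝒜 such that (z_n y_n) converges whenever (z_n) converges, and (z_n) converges to 0, then (z_n y_n) converges to 0. -/
/- STATEMENT 14: In a topological algebra, if right (resp. left) multiplication by a
   sequence preserves convergence, then it sends null sequences to null sequences. -/

open Filter Topology

/-- If a sequence of zero-preserving maps sends null sequences to convergent sequences, then it
sends null sequences to null sequences. -/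
theorem tendsto_zero_of_convergence_preserving {X Y : Type*} [Zero X] [TopologicalSpace X]
    [Zero Y] [TopologicalSpace Y] [T2Space Y] (f : ℕ → X → Y) (hf0 : ∀ n, f n 0 = 0)
    (hf : ∀ z : ℕ → X, Tendsto z atTop (𝓝 0) → ∃ w, Tendsto (fun n => f n (z n)) atTop (𝓝 w))
    {z : ℕ → X} (hz : Tendsto z atTop (𝓝 0)) :
    Tendsto (fun n => f n (z n)) atTop (𝓝 0) := by
  obtain ⟨w, hw⟩ := hf z hz
  obtain ⟨v, hv⟩ := hf (fun n => if Even n then z n else 0)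
    (hz.if' tendsto_const_nhds)
  have heven : Tendsto (fun k : ℕ => 2 * k) atTop atTop :=
    tendsto_id.const_mul_atTop' two_pos
  have hodd : Tendsto (fun k : ℕ => 2 * k + 1) atTop atTop :=
    tendsto_atTop_mono (fun k => Nat.le_succ (2 * k)) heven
  have hvw : v = w := by
    refine tendsto_nhds_unique (hv.comp heven) ((hw.comp heven).congr fun k => ?_)
    simp
  have hv0 : v = 0 := by
    refine tendsto_nhds_unique (hv.comp hodd) (tendsto_const_nhds.congr fun k => ?_)
    simp [hf0]
  rwa [← hvw, hv0] at hw

theorem convergence_preserving_of_null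
    {𝒜 : Type*} [Ring 𝒜] [Module ℝ 𝒜] [TopologicalSpace 𝒜]
    -- (𝒜, τ) is a Hausdorff locally convex topological vector space:
    [IsTopologicalAddGroup 𝒜] [ContinuousSMul ℝ 𝒜] [T2Space 𝒜] [LocallyConvexSpace ℝ 𝒜]
    -- multiplication is separately continuous:
    (hmulL : ∀ a : 𝒜, Continuous (fun b => a * b))
    (hmulR : ∀ a : 𝒜, Continuous (fun b => b * a)) :
    (∀ x : ℕ → 𝒜,
      (∀ z : ℕ → 𝒜, (∃ w, Tendsto z atTop (𝓝 w)) → ∃ w, Tendsto (fun n => x n * z n) atTop (𝓝 w)) →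
      ∀ z : ℕ → 𝒜, Tendsto z atTop (𝓝 0) → Tendsto (fun n => x n * z n) atTop (𝓝 0)) ∧
    (∀ y : ℕ → 𝒜,
      (∀ z : ℕ → 𝒜, (∃ w, Tendsto z atTop (𝓝 w)) → ∃ w, Tendsto (fun n => z n * y n) atTop (𝓝 w)) →
      ∀ z : ℕ → 𝒜, Tendsto z atTop (𝓝 0) → Tendsto (fun n => z n * y n) atTop (𝓝 0)) := by
  exact ⟨fun x hx _ hz => tendsto_zero_of_convergence_preserving (fun n b => x n * b)
      (fun n => mul_zero (x n)) (fun z h => hx z ⟨0, h⟩) hz,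
    fun y hy _ hz => tendsto_zero_of_convergence_preserving (fun n b => b * y n)
      (fun n => zero_mul (y n)) (fun z h => hy z ⟨0, h⟩) hz⟩
end
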